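/- Let q > 7 be a prime power and set d = gcd(2, q−1). Then PSL₂(q) admits an unmixed Beauville structure of type (((q−1)/d, (q−1)/d, (q−1)/d), ((q+1)/d, (q+1)/d, (q+1)/d)). -/

import Mathlib

open Matrix

/-- The projective special linear group `PSL₂(F) = SL(2, F) / Z(SL(2, F))`. -/
abbrev PSL2 (F : Type*) [Field F] :=
  Matrix.SpecialLinearGroup (Fin 2) F ⧸ Subgroup.center (Matrix.SpecialLinearGroup (Fin 2) F)

/-- `Σ(a)`: the union of the conjugacy classes of all powers of `a`. -/
def conjPowers {G : Type*} [Group G] (a : G) : Set G :=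
  {x | ∃ (g : G) (j : ℕ), x = g * a ^ j * g⁻¹}

/-- `Σ(a, b, c)`: the union of the conjugacy classes of all powers of `a`, of `b`, and
of `c`. -/
def sigma3 {G : Type*} [Group G] (a b c : G) : Set G :=
  conjPowers a ∪ conjPowers b ∪ conjPowers c

/-- An unmixed Beauville structure for a group `G`: two triples, each with product `1` and
generating `G`, whose `Σ`-sets intersect trivially. -/
def IsUnmixedBeauville {G : Type*} [Group G] (a₁ b₁ c₁ a₂ b₂ c₂ : G) : Prop :=
  a₁ * b₁ * c₁ = 1 ∧ a₂ * b₂ * c₂ = 1 ∧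
  Subgroup.closure ({a₁, b₁} : Set G) = ⊤ ∧ Subgroup.closure ({a₂, b₂} : Set G) = ⊤ ∧
  sigma3 a₁ b₁ c₁ ∩ sigma3 a₂ b₂ c₂ = {1}

/-- `G` admits an unmixed Beauville structure of type `((r₁,s₁,t₁),(r₂,s₂,t₂))`. -/
def HasBeauvilleOfType (G : Type*) [Group G] (r₁ s₁ t₁ r₂ s₂ t₂ : ℕ) : Prop :=
  ∃ a₁ b₁ c₁ a₂ b₂ c₂ : G, IsUnmixedBeauville a₁ b₁ c₁ a₂ b₂ c₂ ∧
    orderOf a₁ = r₁ ∧ orderOf b₁ = s₁ ∧ orderOf c₁ = t₁ ∧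
    orderOf a₂ = r₂ ∧ orderOf b₂ = s₂ ∧ orderOf c₂ = t₂

namespace Matrix.SpecialLinearGroup

open scoped MatrixGroups

section Split

variable {F : Type*} [Field F]

lemma diag2_mul_fin_two (a b : F) (ha : a ≠ 0) (hb : b ≠ 0) :
    diag2 a ha * diag2 b hb = diag2 (a * b) (mul_ne_zero ha hb) := by
  apply Subtype.ext
  simp [diag2_coe', mul_comm]

lemma fin_two_det (g : SL(2, F)) : g 0 0 * g 1 1 - g 0 1 * g 1 0 = 1 := by
  rw [← Matrix.det_fin_two, det_coe]

lemma transvection_zero_one_coe (x : F) :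
    (transvection (zero_ne_one (α := Fin 2)) x : Matrix (Fin 2) (Fin 2) F) = !![1, x; 0, 1] := by
  ext i j
  fin_cases i <;> fin_cases j <;> simp [transvection_coe]

lemma transvection_one_zero_coe (x : F) :
    (transvection (one_ne_zero (α := Fin 2)) x : Matrix (Fin 2) (Fin 2) F) = !![1, 0; x, 1] := by
  ext i j
  fin_cases i <;> fin_cases j <;> simp [transvection_coe]

variable {H : Subgroup SL(2, F)}

lemma eq_top_of_transvection_mem (hT : ∀ y : F, transvection (zero_ne_one (α := Fin 2)) y ∈ H)
    {g : SL(2, F)} (hg : g ∈ H) (hgc : g 1 0 ≠ 0) : H = ⊤ := by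
  have hdet : g 0 0 * g 1 1 - g 0 1 * g 1 0 = 1 := by
    have := g.det_coe
    rwa [Matrix.det_fin_two] at this
  have hw := H.mul_mem (H.mul_mem (hT (-(g 0 0) / g 1 0)) hg) (hT (-(g 1 1) / g 1 0))
  set w := transvection (zero_ne_one (α := Fin 2)) (-(g 0 0) / g 1 0) * g *
    transvection (zero_ne_one (α := Fin 2)) (-(g 1 1) / g 1 0) with hwdef
  have hwc : (w : Matrix (Fin 2) (Fin 2) F) = !![0, -(g 1 0)⁻¹; g 1 0, 0] := by
    rw [hwdef, coe_mul, coe_mul, transvection_zero_one_coe, transvection_zero_one_coe,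
      Matrix.eta_fin_two (g : Matrix (Fin 2) (Fin 2) F)]
    simp
    refine ⟨⟨?_, ?_⟩, ?_⟩
    · field_simp
      ring
    · field_simp
      linear_combination -hdet
    · field_simp
      ring
  refine top_le_iff.1 fun A _ ↦ SL2.transvection_induction (· ∈ H) ?_ (fun _ _ ↦ H.mul_mem) A
  intro i j hij c
  fin_cases i <;> fin_cases j
  · exact absurd rfl hij
  · exact hT c
  · convert H.mul_mem (H.mul_mem hw (hT (-c / g 1 0 ^ 2))) (H.inv_mem hw) using 1
    apply Subtype.ext
    change (transvection (one_ne_zero (α := Fin 2)) c : Matrix (Fin 2) (Fin 2) F) = _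
    rw [coe_mul, coe_mul, coe_inv, hwc, transvection_zero_one_coe, transvection_one_zero_coe]
    simp [hgc]
    field_simp
  · exact absurd rfl hij

lemma conj_diag2_coe (g : SL(2, F)) (t : F) (ht : t ≠ 0) :
    ((g * diag2 t ht * g⁻¹ : SL(2, F)) : Matrix (Fin 2) (Fin 2) F) =
      !![g 0 0 * g 1 1 * t - g 0 1 * g 1 0 * t⁻¹, g 0 0 * g 0 1 * (t⁻¹ - t);
        g 1 0 * g 1 1 * (t - t⁻¹), g 0 0 * g 1 1 * t⁻¹ - g 0 1 * g 1 0 * t] := by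
  rw [coe_mul, coe_mul, coe_inv, diag2_coe', Matrix.adjugate_fin_two,
    Matrix.eta_fin_two (g : Matrix (Fin 2) (Fin 2) F)]
  ext i j
  fin_cases i <;> fin_cases j <;> simp <;> ring

lemma sub_inv_ne_zero_of_sq_ne_one {t : F} (ht : t ≠ 0) (ht1 : t ^ 2 ≠ 1) : t - t⁻¹ ≠ 0 := by
  intro h
  field_simp at h
  exact ht1 (by linear_combination h)

lemma conj_diag2_mul (g : SL(2, F)) (t : F) (ht : t ≠ 0) :
    (g * diag2 t ht * g⁻¹ : SL(2, F)) 0 0 * (g * diag2 t ht * g⁻¹ : SL(2, F)) 1 1 =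
      1 - g 0 0 * g 1 1 * (g 0 0 * g 1 1 - 1) * (t - t⁻¹) ^ 2 := by
  have h := fin_two_det g
  rw [conj_diag2_coe]
  simp
  have : g 0 1 * g 1 0 = g 0 0 * g 1 1 - 1 := by linear_combination -h
  rw [this]
  field_simp
  ring

lemma conj_diag2_entries_ne_zero {g : SL(2, F)} (hc : g 1 0 ≠ 0) (hd : g 1 1 ≠ 0) {t : F}
    (ht : t ≠ 0) (ht1 : t ^ 2 ≠ 1)
    (h0 : 1 - g 0 0 * g 1 1 * (g 0 0 * g 1 1 - 1) * (t - t⁻¹) ^ 2 ≠ 0) :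
    (g * diag2 t ht * g⁻¹ : SL(2, F)) 0 0 ≠ 0 ∧ (g * diag2 t ht * g⁻¹ : SL(2, F)) 1 0 ≠ 0 := by
  rw [← conj_diag2_mul g t ht] at h0
  refine ⟨left_ne_zero_of_mul h0, ?_⟩
  rw [conj_diag2_coe]
  simp [hc, hd, sub_inv_ne_zero_of_sq_ne_one ht ht1]

lemma diag2_pow (a : F) (ha : a ≠ 0) (n : ℕ) :
    diag2 a ha ^ n = diag2 (a ^ n) (pow_ne_zero n ha) := by
  induction n with
  | zero => apply Subtype.ext; simp [diag2_coe', Matrix.one_fin_two]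
  | succ n ih =>
    simp only [pow_succ, ih, diag2_mul_fin_two]

lemma pow_sub_inv_sq_ne {l : F} (hl : l ≠ 0) {i k : ℕ} (h1 : l ^ (2 * k) ≠ 1)
    (h2 : l ^ (4 * i + 2 * k) ≠ 1) :
    (l ^ i - (l ^ i)⁻¹) ^ 2 ≠ (l ^ (i + k) - (l ^ (i + k))⁻¹) ^ 2 := by
  intro h
  have hz : (l ^ (2 * k) - 1) * (1 - l ^ (4 * i + 2 * k)) = 0 := by
    rw [pow_add] at h
    have e1 : l ^ (2 * k) = (l ^ k) ^ 2 := by ring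
    have e2 : l ^ (4 * i + 2 * k) = (l ^ i) ^ 4 * (l ^ k) ^ 2 := by ring
    rw [e1, e2]
    have hx : l ^ i ≠ 0 := pow_ne_zero _ hl
    have hy : l ^ k ≠ 0 := pow_ne_zero _ hl
    generalize l ^ i = x at *
    generalize l ^ k = y at *
    field_simp at h
    have : (x ^ 2 - 1) ^ 2 * y ^ 2 = (x ^ 2 * y ^ 2 - 1) ^ 2 := by linear_combination h
    linear_combination this
  rcases mul_eq_zero.1 hz with h' | h'
  · exact h1 (sub_eq_zero.1 h')
  · exact h2 (sub_eq_zero.1 h').symm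

variable [Finite F]

lemma transvection_mem_of_diag2_mem (hT : ∀ (t : F) (ht : t ≠ 0), diag2 t ht ∈ H) {x : F}
    (hx : x ≠ 0) (hxH : transvection (zero_ne_one (α := Fin 2)) x ∈ H) (y : F) :
    transvection (zero_ne_one (α := Fin 2)) y ∈ H := by
  have hsq (t : F) : transvection (zero_ne_one (α := Fin 2)) (t ^ 2 * x) ∈ H := by
    by_cases ht : t = 0
    · simp [ht]
    have := H.mul_mem (H.mul_mem (hT t ht) hxH) (H.inv_mem (hT t ht))
    convert this using 1
    apply Subtype.ext
    rw [diag2_inv, coe_mul, coe_mul, diag2_coe', diag2_coe', transvection_zero_one_coe,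
      transvection_zero_one_coe]
    simp [ht]
    ring
  by_cases h2 : ringChar F = 2
  · obtain ⟨t, ht⟩ := FiniteField.isSquare_of_char_two h2 (y / x)
    convert hsq t using 2
    field_simp at ht
    rw [ht, mul_comm]
  · have h2' : (2 : F) ≠ 0 := Ring.two_ne_zero h2
    have h4' : (4 : F) ≠ 0 := by
      have : (4 : F) = 2 * 2 := by norm_num
      rw [this]; exact mul_ne_zero h2' h2'
    convert H.mul_mem (hsq ((y / x + 1) / 2)) (H.inv_mem (hsq ((y / x - 1) / 2))) using 1
    rw [transvection_inv, ← transvection_add]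
    congr 1
    field_simp
    ring

lemma eq_top_of_upper_mem (hT : ∀ (t : F) (ht : t ≠ 0), diag2 t ht ∈ H)
    {k g : SL(2, F)} (hk : k ∈ H) (hk0 : k 1 0 = 0) (hk1 : k 0 1 ≠ 0)
    (hg : g ∈ H) (hgc : g 1 0 ≠ 0) : H = ⊤ := by
  have hdet : k 0 0 * k 1 1 = 1 := by
    have := k.det_coe
    rwa [Matrix.det_fin_two, hk0, mul_zero, sub_zero] at this
  have ha : k 0 0 ≠ 0 := left_ne_zero_of_mul_eq_one hdet
  refine eq_top_of_transvection_mem (transvection_mem_of_diag2_mem hT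
    (mul_ne_zero hk1 ha) ?_) hg hgc
  convert H.mul_mem hk (hT (k 0 0)⁻¹ (inv_ne_zero ha)) using 1
  apply Subtype.ext
  rw [transvection_zero_one_coe, coe_mul, diag2_coe',
    Matrix.eta_fin_two (k : Matrix (Fin 2) (Fin 2) F)]
  simp [hk0, ha, mul_comm, hdet]

lemma eq_top_of_pair (hT : ∀ (t : F) (ht : t ≠ 0), diag2 t ht ∈ H)
    {g h : SL(2, F)} (hg : g ∈ H) (hh : h ∈ H) (hga : g 0 0 ≠ 0) (hgc : g 1 0 ≠ 0)
    (hha : h 0 0 ≠ 0) (hhc : h 1 0 ≠ 0)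
    (hsq : IsSquare ((g 0 0 * g 1 0) * (h 0 0 * h 1 0)))
    (hne : g 0 0 * g 1 1 ≠ h 0 0 * h 1 1) : H = ⊤ := by
  have hdg : g 0 0 * g 1 1 - g 0 1 * g 1 0 = 1 := by
    have := g.det_coe
    rwa [Matrix.det_fin_two] at this
  have hdh : h 0 0 * h 1 1 - h 0 1 * h 1 0 = 1 := by
    have := h.det_coe
    rwa [Matrix.det_fin_two] at this
  obtain ⟨s, hs⟩ := hsq
  have hs0 : s ≠ 0 := by
    rintro rfl
    simp_all
  have ht0 : s / (h 1 0 * g 0 0) ≠ 0 := div_ne_zero hs0 (mul_ne_zero hhc hga)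
  have ht : (s / (h 1 0 * g 0 0)) ^ 2 * (h 1 0 * g 0 0) = h 0 0 * g 1 0 := by
    field_simp
    linear_combination -hs
  set t := s / (h 1 0 * g 0 0)
  have hk := H.mul_mem (H.mul_mem (H.inv_mem hh) (hT t ht0)) hg
  have hkc : ((h⁻¹ * diag2 t ht0 * g : SL(2, F)) : Matrix (Fin 2) (Fin 2) F) =
      !![h 1 1 * t * g 0 0 - h 0 1 * t⁻¹ * g 1 0, h 1 1 * t * g 0 1 - h 0 1 * t⁻¹ * g 1 1;
        -h 1 0 * t * g 0 0 + h 0 0 * t⁻¹ * g 1 0, -h 1 0 * t * g 0 1 + h 0 0 * t⁻¹ * g 1 1] := by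
    rw [coe_mul, coe_mul, coe_inv, diag2_coe', Matrix.adjugate_fin_two,
      Matrix.eta_fin_two (g : Matrix (Fin 2) (Fin 2) F)]
    simp
    constructor <;> ring
  refine eq_top_of_upper_mem hT hk ?_ ?_ hg hgc
  · rw [hkc]
    simp
    field_simp
    linear_combination -ht
  · rw [hkc]
    simp
    intro h0
    field_simp at h0
    apply hne
    have : (h 1 1 * g 0 1 * (h 0 0 * g 1 0)) = h 0 1 * g 1 1 * (h 1 0 * g 0 0) := by
      rw [← ht]
      linear_combination (h 1 0 * g 0 0) * h0
    linear_combination this + h 0 0 * h 1 1 * hdg - g 0 0 * g 1 1 * hdh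

lemma isSquare_mul_of_three {x y z : F} (hx : x ≠ 0) (hy : y ≠ 0) (hz : z ≠ 0) :
    IsSquare (x * y) ∨ IsSquare (x * z) ∨ IsSquare (y * z) := by
  have := Fintype.ofFinite F
  by_cases h2 : ringChar F = 2
  · exact Or.inl (FiniteField.isSquare_of_char_two h2 _)
  rw [FiniteField.isSquare_iff h2 (mul_ne_zero hx hy), FiniteField.isSquare_iff h2
    (mul_ne_zero hx hz), FiniteField.isSquare_iff h2 (mul_ne_zero hy hz), mul_pow, mul_pow, mul_pow]
  rcases FiniteField.pow_dichotomy h2 hx with h | h <;>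
  rcases FiniteField.pow_dichotomy h2 hy with h' | h' <;>
  rcases FiniteField.pow_dichotomy h2 hz with h'' | h'' <;> simp [h, h', h'']

lemma eq_top_of_conj_eq_zero (hT : ∀ (t : F) (ht : t ≠ 0), diag2 t ht ∈ H)
    {g : SL(2, F)} (hg : g ∈ H) (hc : g 1 0 ≠ 0) {t : F} (ht : t ≠ 0) (ht1 : t ^ 2 ≠ 1)
    (htr : t ^ 2 ≠ -1)
    (h0 : 1 - g 0 0 * g 1 1 * (g 0 0 * g 1 1 - 1) * (t - t⁻¹) ^ 2 = 0) : H = ⊤ := by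
  rw [← conj_diag2_mul g t ht] at h0
  have hkH := H.mul_mem (H.mul_mem hg (hT t ht)) (H.inv_mem hg)
  have hks : (g * diag2 t ht * g⁻¹ : SL(2, F)) 0 0 + (g * diag2 t ht * g⁻¹ : SL(2, F)) 1 1 ≠ 0 := by
    rw [conj_diag2_coe]
    simp
    intro h
    apply htr
    field_simp at h
    linear_combination h - (1 + t ^ 2) * fin_two_det g
  set k := g * diag2 t ht * g⁻¹
  have hkd := fin_two_det k
  have hs := sub_inv_ne_zero_of_sq_ne_one ht ht1
  have hs' : t⁻¹ - t ≠ 0 := by rwa [← neg_sub, neg_ne_zero]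
  rcases mul_eq_zero.1 h0 with h | h
  · have hd : k 1 1 ≠ 0 := by simpa [h] using hks
    have hb : k 0 1 ≠ 0 := by
      intro hb
      simp [h, hb] at hkd
    refine eq_top_of_upper_mem hT (H.mul_mem (H.mul_mem (H.inv_mem hkH) (hT t ht)) hkH)
      ?_ ?_ hg hc
    · have := conj_diag2_coe k⁻¹ t ht
      rw [inv_inv] at this
      rw [this]
      simp [coe_inv, Matrix.adjugate_fin_two, h]
    · have := conj_diag2_coe k⁻¹ t ht
      rw [inv_inv] at this
      rw [this]
      simp [coe_inv, Matrix.adjugate_fin_two, hd, hb, hs']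
  · have ha : k 0 0 ≠ 0 := by simpa [h] using hks
    have hb : k 0 1 ≠ 0 := by
      intro hb
      simp [h, hb] at hkd
    refine eq_top_of_upper_mem hT (H.mul_mem (H.mul_mem hkH (hT t ht)) (H.inv_mem hkH))
      ?_ ?_ hg hc
    · rw [conj_diag2_coe]
      simp [h]
    · rw [conj_diag2_coe]
      simp [ha, hb, hs']

lemma eq_top_of_conj_of_ringChar (h2 : ringChar F = 2)
    (hT : ∀ (t : F) (ht : t ≠ 0), diag2 t ht ∈ H)
    {g : SL(2, F)} (hg : g ∈ H) (ha : g 0 0 ≠ 0) (hc : g 1 0 ≠ 0) (hd : g 1 1 ≠ 0)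
    {t : F} (ht : t ≠ 0) (ht1 : t ^ 2 ≠ 1)
    (h0 : 1 - g 0 0 * g 1 1 * (g 0 0 * g 1 1 - 1) * (t - t⁻¹) ^ 2 ≠ 0)
    (h1 : 1 - g 0 0 * g 1 1 * (g 0 0 * g 1 1 - 1) * (t - t⁻¹) ^ 2 ≠ g 0 0 * g 1 1) :
    H = ⊤ := by
  obtain ⟨hk0, hk1⟩ := conj_diag2_entries_ne_zero hc hd ht ht1 h0
  refine eq_top_of_pair hT hg (H.mul_mem (H.mul_mem hg (hT t ht)) (H.inv_mem hg))
    ha hc hk0 hk1 (FiniteField.isSquare_of_char_two h2 _) ?_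
  rw [conj_diag2_mul]
  exact h1.symm

lemma eq_top_of_two_conj
    (hT : ∀ (t : F) (ht : t ≠ 0), diag2 t ht ∈ H)
    {g : SL(2, F)} (hg : g ∈ H) (ha : g 0 0 ≠ 0) (hc : g 1 0 ≠ 0) (hd : g 1 1 ≠ 0)
    {t s : F} (ht : t ≠ 0) (ht1 : t ^ 2 ≠ 1) (hs : s ≠ 0) (hs1 : s ^ 2 ≠ 1)
    (h0 : 1 - g 0 0 * g 1 1 * (g 0 0 * g 1 1 - 1) * (t - t⁻¹) ^ 2 ≠ 0)
    (h1 : 1 - g 0 0 * g 1 1 * (g 0 0 * g 1 1 - 1) * (t - t⁻¹) ^ 2 ≠ g 0 0 * g 1 1)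
    (h0' : 1 - g 0 0 * g 1 1 * (g 0 0 * g 1 1 - 1) * (s - s⁻¹) ^ 2 ≠ 0)
    (h1' : 1 - g 0 0 * g 1 1 * (g 0 0 * g 1 1 - 1) * (s - s⁻¹) ^ 2 ≠ g 0 0 * g 1 1)
    (hts : 1 - g 0 0 * g 1 1 * (g 0 0 * g 1 1 - 1) * (t - t⁻¹) ^ 2 ≠
      1 - g 0 0 * g 1 1 * (g 0 0 * g 1 1 - 1) * (s - s⁻¹) ^ 2) :
    H = ⊤ := by
  obtain ⟨hk0, hk1⟩ := conj_diag2_entries_ne_zero hc hd ht ht1 h0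
  obtain ⟨hl0, hl1⟩ := conj_diag2_entries_ne_zero hc hd hs hs1 h0'
  have hk := H.mul_mem (H.mul_mem hg (hT t ht)) (H.inv_mem hg)
  have hl := H.mul_mem (H.mul_mem hg (hT s hs)) (H.inv_mem hg)
  rw [← conj_diag2_mul g t ht, ← conj_diag2_mul g s hs] at hts
  rw [← conj_diag2_mul g t ht] at h1
  rw [← conj_diag2_mul g s hs] at h1'
  rcases isSquare_mul_of_three (mul_ne_zero ha hc) (mul_ne_zero hk0 hk1) (mul_ne_zero hl0 hl1) with
    h | h | h
  · exact eq_top_of_pair hT hg hk ha hc hk0 hk1 h h1.symm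
  · exact eq_top_of_pair hT hg hl ha hc hl0 hl1 h h1'.symm
  · exact eq_top_of_pair hT hk hl hk0 hk1 hl0 hl1 h hts

lemma diag2_mem_of_orderOf {l : F} (hl : l ≠ 0) (hord : orderOf l = Nat.card F - 1)
    (h : diag2 l hl ∈ H) (t : F) (ht : t ≠ 0) : diag2 t ht ∈ H := by
  have : Fintype F := Fintype.ofFinite F
  have h1 : orderOf (Units.mk0 l hl) = Nat.card Fˣ := by
    rw [← orderOf_units, Units.val_mk0, hord, Nat.card_units]
  have h2 : Units.mk0 t ht ∈ Subgroup.zpowers (Units.mk0 l hl) := by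
    rw [Subgroup.eq_top_of_card_eq _ ((Nat.card_zpowers _).trans h1)]
    trivial
  rw [← mem_powers_iff_mem_zpowers] at h2
  obtain ⟨n, hn⟩ := h2
  have hn' : l ^ n = t := by simpa using congrArg Units.val hn
  subst hn'
  rw [← diag2_pow l hl n]
  exact H.pow_mem h n

lemma not_isPrimePow_of_two_primes {n p r : ℕ} (hp : p.Prime) (hr : r.Prime) (hpr : p ≠ r)
    (hpn : p ∣ n) (hrn : r ∣ n) : ¬ IsPrimePow n := fun h ↦
  hpr ((isPrimePow_iff_unique_prime_dvd.1 h).unique ⟨hp, hpn⟩ ⟨hr, hrn⟩)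

lemma of_three_distinct {α : Type*} {P : Prop} {a b x y z : α} (hxy : x ≠ y) (hxz : x ≠ z)
    (hyz : y ≠ z) (fx : x ≠ a → x ≠ b → P) (fy : y ≠ a → y ≠ b → P) (fz : z ≠ a → z ≠ b → P) :
    P := by
  by_cases hx : x = a ∨ x = b <;> by_cases hy : y = a ∨ y = b <;>
    by_cases hz : z = a ∨ z = b <;> grind

lemma of_four_distinct {α : Type*} {P : Prop} {a b x y z t : α} (hxy : x ≠ y) (hxz : x ≠ z)
    (hxt : x ≠ t) (hyz : y ≠ z) (hyt : y ≠ t) (hzt : z ≠ t)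
    (fxy : x ≠ a → x ≠ b → y ≠ a → y ≠ b → P) (fxz : x ≠ a → x ≠ b → z ≠ a → z ≠ b → P)
    (fxt : x ≠ a → x ≠ b → t ≠ a → t ≠ b → P) (fyz : y ≠ a → y ≠ b → z ≠ a → z ≠ b → P)
    (fyt : y ≠ a → y ≠ b → t ≠ a → t ≠ b → P) (fzt : z ≠ a → z ≠ b → t ≠ a → t ≠ b → P) :
    P := by
  by_cases hx : x = a ∨ x = b <;> by_cases hy : y = a ∨ y = b <;>
    by_cases hz : z = a ∨ z = b <;> by_cases ht : t = a ∨ t = b <;> grind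

/-- A subgroup of `SL(2, F)` containing a full split torus and a suitable further element is
everything. -/
lemma eq_top_of_split_torus (hq : 7 < Nat.card F) (hpp : IsPrimePow (Nat.card F)) {l : F}
    (hl : l ≠ 0) (hord : orderOf l = Nat.card F - 1) (hlH : diag2 l hl ∈ H) {g : SL(2, F)}
    (hg : g ∈ H) (hc : g 1 0 ≠ 0) (ha : g 0 0 = (l ^ 2 + 1) / (l * (l - 1)))
    (hd : g 1 1 = -(l ^ 2 + 1) / (l - 1)) : H = ⊤ := by
  have hT := diag2_mem_of_orderOf hl hord hlH
  have hpow {n : ℕ} (hn : 0 < n) (hn' : n < Nat.card F - 1) : l ^ n ≠ 1 :=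
    pow_ne_one_of_lt_orderOf hn.ne' (hord ▸ hn')
  have hone : l ^ (Nat.card F - 1) = 1 := hord ▸ pow_orderOf_eq_one l
  have hl1 : l - 1 ≠ 0 := sub_ne_zero.2 (by simpa using hpow (n := 1) (by norm_num) (by omega))
  have hl2 : l ^ 2 + 1 ≠ 0 := by
    intro h
    refine hpow (n := 4) (by norm_num) (by omega) ?_
    linear_combination (l ^ 2 - 1) * h
  have ha0 : g 0 0 ≠ 0 := by
    rw [ha]
    exact div_ne_zero hl2 (mul_ne_zero hl hl1)
  have hd0 : g 1 1 ≠ 0 := by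
    rw [hd]
    exact div_ne_zero (neg_ne_zero.2 hl2) hl1
  have hu1 : g 0 0 * g 1 1 - 1 ≠ 0 := by
    intro h
    rw [ha, hd] at h
    field_simp at h
    have h6 : (l ^ 2 - l + 1) * (l + 1) ^ 2 = 0 := by linear_combination -h
    rcases mul_eq_zero.1 h6 with h | h
    · refine hpow (n := 6) (by norm_num) (by omega) ?_
      linear_combination (l + 1) * (l ^ 3 - 1) * h
    · refine hpow (n := 2) (by norm_num) (by omega) ?_
      linear_combination (l - 1) * (pow_eq_zero_iff two_ne_zero).1 h
  set w : ℕ → F := fun i ↦ 1 - g 0 0 * g 1 1 * (g 0 0 * g 1 1 - 1) * (l ^ i - (l ^ i)⁻¹) ^ 2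
    with hw
  have hwne {i k : ℕ} (h1 : l ^ (2 * k) ≠ 1) (h2 : l ^ (4 * i + 2 * k) ≠ 1) :
      w i ≠ w (i + k) := by
    intro h
    refine pow_sub_inv_sq_ne hl h1 h2 ?_
    simp only [hw, sub_right_inj] at h
    exact mul_left_cancel₀ (mul_ne_zero (mul_ne_zero ha0 hd0) hu1) h
  have hsq {i : ℕ} (h : l ^ (2 * i) ≠ 1) : (l ^ i) ^ 2 ≠ 1 := by rwa [← pow_mul, mul_comm]
  have hfin {i k : ℕ} (hi : l ^ (2 * i) ≠ 1) (hk : l ^ (2 * k) ≠ 1)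
      (h0 : w i ≠ 0) (h1 : w i ≠ g 0 0 * g 1 1) (h0' : w k ≠ 0) (h1' : w k ≠ g 0 0 * g 1 1)
      (hik : w i ≠ w k) : H = ⊤ :=
    eq_top_of_two_conj hT hg ha0 hc hd0 (pow_ne_zero i hl) (hsq hi) (pow_ne_zero k hl) (hsq hk)
      h0 h1 h0' h1' hik
  have hcast : ((Nat.card F : ℕ) : F) = 0 := by
    have := Fintype.ofFinite F
    rw [Nat.card_eq_fintype_card]
    exact FiniteField.cast_card_eq_zero F
  have huv {i : ℕ} {u v : F} (hu : -(l ^ 2 + 1) ^ 2 = u * (l * (l - 1) ^ 2))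
      (hv : (l ^ (2 * i) - 1) ^ 2 = v * l ^ (2 * i)) :
      g 0 0 * g 1 1 = u ∧ w i = 1 - u * (u - 1) * v := by
    have h1 : g 0 0 * g 1 1 = u := by
      rw [ha, hd]
      field_simp
      linear_combination hu
    have h2 : (l ^ i - (l ^ i)⁻¹) ^ 2 = v := by
      have hli := pow_ne_zero i hl
      rw [mul_comm 2 i, pow_mul] at hv
      field_simp
      rw [hv, mul_comm]
    simp only [hw, h1, h2, and_self]
  rcases le_or_gt 16 (Nat.card F) with h16 | h16
  · have e1 : l ^ (2 * 1) ≠ 1 := hpow (by norm_num) (by omega)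
    have e2 : l ^ (2 * 2) ≠ 1 := hpow (by norm_num) (by omega)
    have e3 : l ^ (2 * 3) ≠ 1 := hpow (by norm_num) (by omega)
    have e4 : l ^ (2 * 4) ≠ 1 := hpow (by norm_num) (by omega)
    have h12 : w 1 ≠ w 2 := hwne e1 (hpow (by norm_num) (by omega))
    have h13 : w 1 ≠ w 3 := hwne e2 (hpow (by norm_num) (by omega))
    have h14 : w 1 ≠ w 4 := hwne e3 (hpow (by norm_num) (by omega))
    have h23 : w 2 ≠ w 3 := hwne e1 (hpow (by norm_num) (by omega))
    have h24 : w 2 ≠ w 4 := hwne e2 (hpow (by norm_num) (by omega))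
    have h34 : w 3 ≠ w 4 := hwne e1 (hpow (by norm_num) (by omega))
    exact of_four_distinct h12 h13 h14 h23 h24 h34
      (fun a b c d ↦ hfin e1 e2 a b c d h12) (fun a b c d ↦ hfin e1 e3 a b c d h13)
      (fun a b c d ↦ hfin e1 e4 a b c d h14) (fun a b c d ↦ hfin e2 e3 a b c d h23)
      (fun a b c d ↦ hfin e2 e4 a b c d h24) (fun a b c d ↦ hfin e3 e4 a b c d h34)
  have hcases : Nat.card F = 8 ∨ Nat.card F = 9 ∨ Nat.card F = 11 ∨ Nat.card F = 13 := by
    generalize Nat.card F = q at *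
    interval_cases q
    · simp
    · simp
    · exact absurd hpp (not_isPrimePow_of_two_primes (p := 2) (r := 5) (by norm_num)
        (by norm_num) (by norm_num) (by norm_num) (by norm_num))
    · simp
    · exact absurd hpp (not_isPrimePow_of_two_primes (p := 2) (r := 3) (by norm_num)
        (by norm_num) (by norm_num) (by norm_num) (by norm_num))
    · simp
    · exact absurd hpp (not_isPrimePow_of_two_primes (p := 2) (r := 7) (by norm_num)
        (by norm_num) (by norm_num) (by norm_num) (by norm_num))
    · exact absurd hpp (not_isPrimePow_of_two_primes (p := 3) (r := 5) (by norm_num)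
        (by norm_num) (by norm_num) (by norm_num) (by norm_num))
  have e1 : l ^ (2 * 1) ≠ 1 := hpow (by norm_num) (by omega)
  have e2 : l ^ (2 * 2) ≠ 1 := hpow (by norm_num) (by omega)
  have e3 : l ^ (2 * 3) ≠ 1 := hpow (by norm_num) (by omega)
  rcases hcases with h8 | h9 | h11 | h13
  · have hc8 : (2 : F) = 0 := by
      rw [h8] at hcast
      have : (2 : F) ^ 3 = 0 := by
        push_cast at hcast
        linear_combination hcast
      exact (pow_eq_zero_iff three_ne_zero).1 this
    have h2 : ringChar F = 2 := CharP.ringChar_of_prime_eq_zero Nat.prime_two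
      (by exact_mod_cast hc8)
    have h7 : l ^ 7 = 1 := by rwa [h8] at hone
    have h12 : w 1 ≠ w 2 := hwne e1 (hpow (by norm_num) (by omega))
    have h13 : w 1 ≠ w 3 := by
      refine hwne e2 fun h ↦ hpow (n := 1) (by norm_num) (by omega) ?_
      linear_combination h - l * h7
    have h23 : w 2 ≠ w 3 := by
      refine hwne e1 fun h ↦ hpow (n := 3) (by norm_num) (by omega) ?_
      linear_combination h - l ^ 3 * h7
    have f {i : ℕ} (hi : l ^ (2 * i) ≠ 1) (h0 : w i ≠ 0) (h1 : w i ≠ g 0 0 * g 1 1) : H = ⊤ :=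
      eq_top_of_conj_of_ringChar h2 hT hg ha0 hc hd0 (pow_ne_zero i hl) (hsq hi) h0 h1
    exact of_three_distinct h12 h13 h23 (f e1) (f e2) (f e3)
  · have hc9 : (3 : F) = 0 := by
      rw [h9] at hcast
      have : (3 : F) ^ 2 = 0 := by
        push_cast at hcast
        linear_combination hcast
      exact (pow_eq_zero_iff two_ne_zero).1 this
    have h4 : l ^ 4 + 1 = 0 := by
      rw [h9] at hone
      refine ((mul_eq_zero (a := l ^ 4 - 1)).1 ?_).resolve_left (sub_ne_zero.2 e2)
      linear_combination hone
    refine eq_top_of_conj_eq_zero hT hg hc hl (by simpa using e1) ?_ ?_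
    · intro h
      refine e2 ?_
      linear_combination (l ^ 2 - 1) * h
    · rw [ha, hd]
      field_simp
      linear_combination (l - 1) ^ 2 * (-4 - 9 * l - 8 * l ^ 2 - 8 * l ^ 3 - 5 * l ^ 4 -
        3 * l ^ 5 - l ^ 6) * h4 + (l - 1) ^ 2 * (1 + 2 * l + l ^ 2) * hc9
  · have hc11 : (11 : F) = 0 := by simpa [h11] using hcast
    have h5 : l ^ 5 + 1 = 0 := by
      rw [h11] at hone
      refine ((mul_eq_zero (a := l ^ 5 - 1)).1 ?_).resolve_left
        (sub_ne_zero.2 (hpow (by norm_num) (by omega)))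
      linear_combination hone
    have hf : (1 + 3 * l + l ^ 2) * (1 - 4 * l + l ^ 2) = 0 := by
      have : l ^ 4 - l ^ 3 + l ^ 2 - l + 1 = 0 := by
        refine ((mul_eq_zero (a := l + 1)).1 ?_).resolve_left fun h ↦ e1 ?_
        · linear_combination h5
        · linear_combination (l - 1) * h
      linear_combination this - l ^ 2 * hc11
    rcases mul_eq_zero.1 hf with h | h
    · obtain ⟨hu, hv⟩ := huv (i := 2) (u := 4) (v := 1)
        (by linear_combination (10 - l - l ^ 2) * h + (-1 - 3 * l) * hc11)
        (by linear_combination (353 - 135 * l + 52 * l ^ 2 - 21 * l ^ 3 + 8 * l ^ 4 - 3 * l ^ 5 +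
          l ^ 6) * h + (-32 - 84 * l) * hc11)
      refine eq_top_of_conj_eq_zero hT hg hc (pow_ne_zero 2 hl) (hsq e2) ?_ ?_
      · intro h'
        refine hpow (n := 8) (by norm_num) (by omega) ?_
        linear_combination (l ^ 4 - 1) * h'
      · change w 2 = 0
        rw [hv]
        linear_combination -hc11
    · obtain ⟨hu, hv⟩ := huv (i := 1) (u := 3) (v := 1)
        (by linear_combination (-23 - 7 * l - l ^ 2) * h + (2 - 8 * l) * hc11)
        (by linear_combination (12 + 4 * l + l ^ 2) * h + (-1 + 4 * l) * hc11)
      obtain ⟨-, hv'⟩ := huv (i := 2) (u := 3) (v := 5)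
        (by linear_combination (-23 - 7 * l - l ^ 2) * h + (2 - 8 * l) * hc11)
        (by linear_combination (2806 + 752 * l + 202 * l ^ 2 + 56 * l ^ 3 + 15 * l ^ 4 +
          4 * l ^ 5 + l ^ 6) * h + (-255 + 952 * l) * hc11)
      refine hfin e1 e2 ?_ ?_ ?_ ?_ ?_ <;> simp only [hv, hv', hu] <;> intro h0
      · exact one_ne_zero (α := F) (by linear_combination 2 * h0 + hc11)
      · exact one_ne_zero (α := F) (by linear_combination 4 * h0 + 3 * hc11)
      · exact one_ne_zero (α := F) (by linear_combination 3 * h0 + 8 * hc11)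
      · exact one_ne_zero (α := F) (by linear_combination h0 + 3 * hc11)
      · exact one_ne_zero (α := F) (by linear_combination 6 * h0 - 13 * hc11)
  · have hc13 : (13 : F) = 0 := by simpa [h13] using hcast
    have h6 : l ^ 6 + 1 = 0 := by
      rw [h13] at hone
      refine ((mul_eq_zero (a := l ^ 6 - 1)).1 ?_).resolve_left (sub_ne_zero.2 e3)
      linear_combination hone
    have hf : (1 - 4 * l + l ^ 2) * (1 + 4 * l + l ^ 2) = 0 := by
      have : l ^ 4 - l ^ 2 + 1 = 0 := by
        refine ((mul_eq_zero (a := l ^ 2 + 1)).1 ?_).resolve_left hl2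
        linear_combination h6
      linear_combination this - l ^ 2 * hc13
    rcases mul_eq_zero.1 hf with h | h
    · obtain ⟨hu, hv⟩ := huv (i := 1) (u := 5) (v := -1)
        (by linear_combination (-27 - 9 * l - l ^ 2) * h + (2 - 8 * l) * hc13)
        (by linear_combination (14 + 4 * l + l ^ 2) * h + (-1 + 4 * l) * hc13)
      obtain ⟨-, hv'⟩ := huv (i := 2) (u := 5) (v := 10)
        (by linear_combination (-27 - 9 * l - l ^ 2) * h + (2 - 8 * l) * hc13)
        (by linear_combination (2731 + 732 * l + 197 * l ^ 2 + 56 * l ^ 3 + 15 * l ^ 4 +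
          4 * l ^ 5 + l ^ 6) * h + (-210 + 784 * l) * hc13)
      refine hfin e1 e2 ?_ ?_ ?_ ?_ ?_ <;> simp only [hv, hv', hu] <;> intro h0
      · exact one_ne_zero (α := F) (by linear_combination 5 * h0 - 8 * hc13)
      · exact one_ne_zero (α := F) (by linear_combination -4 * h0 + 5 * hc13)
      · exact one_ne_zero (α := F) (by linear_combination 3 * h0 + 46 * hc13)
      · exact one_ne_zero (α := F) (by linear_combination -3 * h0 - 47 * hc13)
      · exact one_ne_zero (α := F) (by linear_combination -h0 + 17 * hc13)
    · obtain ⟨hu, hv⟩ := huv (i := 1) (u := 7) (v := -1)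
        (by linear_combination (25 - 3 * l - l ^ 2) * h + (-2 - 8 * l) * hc13)
        (by linear_combination (14 - 4 * l + l ^ 2) * h + (-1 - 4 * l) * hc13)
      obtain ⟨-, hv'⟩ := huv (i := 2) (u := 7) (v := 10)
        (by linear_combination (25 - 3 * l - l ^ 2) * h + (-2 - 8 * l) * hc13)
        (by linear_combination (2731 - 732 * l + 197 * l ^ 2 - 56 * l ^ 3 + 15 * l ^ 4 -
          4 * l ^ 5 + l ^ 6) * h + (-210 - 784 * l) * hc13)
      refine hfin e1 e2 ?_ ?_ ?_ ?_ ?_ <;> simp only [hv, hv', hu] <;> intro h0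
      · exact one_ne_zero (α := F) (by linear_combination -3 * h0 + 10 * hc13)
      · exact one_ne_zero (α := F) (by linear_combination 4 * h0 - 11 * hc13)
      · exact one_ne_zero (α := F) (by linear_combination 4 * h0 + 129 * hc13)
      · exact one_ne_zero (α := F) (by linear_combination -4 * h0 - 131 * hc13)
      · exact one_ne_zero (α := F) (by linear_combination 2 * h0 - 71 * hc13)

end Split

section Order

variable {F L : Type*} [Field F] [Field L] [Algebra F L]

lemma mem_center_fin_two_iff (X : SL(2, F)) :
    X ∈ Subgroup.center SL(2, F) ↔ X 0 1 = 0 ∧ X 1 0 = 0 ∧ X 0 0 = X 1 1 := by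
  rw [mem_center_iff]
  constructor
  · rintro ⟨r, -, h⟩
    rw [← h]
    simp
  · rintro ⟨h1, h2, h3⟩
    have hd : X 0 0 * X 1 1 - X 0 1 * X 1 0 = 1 := by rw [← Matrix.det_fin_two, det_coe]
    refine ⟨X 0 0, ?_, ?_⟩
    · rw [h1, ← h3] at hd
      simpa [sq] using hd
    · ext i j
      fin_cases i <;> fin_cases j <;> simp [h1, h2, h3]

/-- Powers of a two by two matrix of determinant one with eigenvalues `μ` and `μ⁻¹`. -/
lemma sub_smul_map_pow {X : SL(2, F)} {μ ν : L} (hμν : μ * ν = 1)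
    (htr : algebraMap F L (X 0 0 + X 1 1) = μ + ν) (k : ℕ) :
    (μ - ν) • ((X ^ k : SL(2, F)) : Matrix (Fin 2) (Fin 2) F).map (algebraMap F L) =
      (μ ^ k - ν ^ k) • (X : Matrix (Fin 2) (Fin 2) F).map (algebraMap F L) -
        (μ ^ k * ν - ν ^ k * μ) • (1 : Matrix (Fin 2) (Fin 2) L) := by
  have hd : X 0 0 * X 1 1 - X 0 1 * X 1 0 = 1 := by rw [← Matrix.det_fin_two, det_coe]
  have hd' := congrArg (algebraMap F L) hd
  simp only [map_sub, map_mul, map_one] at hd'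
  set M := (X : Matrix (Fin 2) (Fin 2) F).map (algebraMap F L) with hM
  have hsq : M * M = (μ + ν) • M - 1 := by
    rw [← htr]
    ext i j
    fin_cases i <;> fin_cases j <;>
      simp [hM, Matrix.mul_apply, Fin.sum_univ_two] <;> first | ring1 | linear_combination -hd'
  induction k with
  | zero => simp [← neg_smul]
  | succ k ih =>
    have h1 : ((X ^ (k + 1) : SL(2, F)) : Matrix (Fin 2) (Fin 2) F).map (algebraMap F L) =
        ((X ^ k : SL(2, F)) : Matrix (Fin 2) (Fin 2) F).map (algebraMap F L) * M := by
      rw [pow_succ, coe_mul, Matrix.map_mul]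
    rw [h1, ← smul_mul_assoc, ih, sub_mul, smul_mul_assoc, hsq, smul_mul_assoc, one_mul, smul_sub,
      smul_smul]
    have e1 : μ ^ (k + 1) * ν = μ ^ k := by rw [pow_succ, mul_assoc, hμν, mul_one]
    have e2 : ν ^ (k + 1) * μ = ν ^ k := by rw [pow_succ, mul_assoc, mul_comm ν, hμν, mul_one]
    rw [e1, e2, sub_right_comm, ← sub_smul]
    congr 2
    rw [pow_succ, pow_succ]
    ring

lemma pow_mem_center_iff {X : SL(2, F)} {μ : L} (hμ : μ ≠ 0) (hμ1 : μ ^ 2 ≠ 1)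
    (htr : algebraMap F L (X 0 0 + X 1 1) = μ + μ⁻¹) (k : ℕ) :
    X ^ k ∈ Subgroup.center SL(2, F) ↔ (μ ^ 2) ^ k = 1 := by
  have hinj := FaithfulSMul.algebraMap_injective F L
  have h := sub_smul_map_pow (mul_inv_cancel₀ hμ) htr k
  have hne : μ - μ⁻¹ ≠ 0 := by
    intro h
    field_simp at h
    exact hμ1 (by linear_combination h)
  have hd : X 0 0 * X 1 1 - X 0 1 * X 1 0 = 1 := by rw [← Matrix.det_fin_two, det_coe]
  have hd' := congrArg (algebraMap F L) hd
  generalize X ^ k = Y at h ⊢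
  have h00 := congrFun₂ h 0 0
  have h01 := congrFun₂ h 0 1
  have h10 := congrFun₂ h 1 0
  have h11 := congrFun₂ h 1 1
  simp at h00 h01 h10 h11 hd' htr
  have hpow : (μ ^ 2) ^ k = 1 ↔ μ ^ k - (μ ^ k)⁻¹ = 0 := by
    have := pow_ne_zero k hμ
    rw [← pow_mul, mul_comm, pow_mul]
    field_simp
    rw [mul_zero, sub_eq_zero]
  rw [mem_center_fin_two_iff, hpow]
  constructor
  · rintro ⟨a, b, c⟩
    by_contra hne'
    rw [a] at h01
    rw [b] at h10
    rw [c] at h00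
    simp [hne'] at h01 h10
    have h2 : (μ ^ k - (μ ^ k)⁻¹) * (algebraMap F L (X 0 0) - algebraMap F L (X 1 1)) = 0 := by
      linear_combination h11 - h00
    have h3 := (mul_eq_zero.1 h2).resolve_left hne'
    rw [h01, h10] at hd'
    simp at hd'
    apply hne
    have : (μ - μ⁻¹) ^ 2 = 0 := by
      have e : (μ + μ⁻¹) ^ 2 - (μ - μ⁻¹) ^ 2 = 4 := by field_simp; ring
      linear_combination -e - htr * (μ + μ⁻¹ + algebraMap F L (X 0 0) + algebraMap F L (X 1 1)) +
        h3 * (algebraMap F L (X 0 0) - algebraMap F L (X 1 1)) + 4 * hd'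
    simpa using this
  · intro h0
    rw [h0] at h00 h01 h10 h11
    simp [hne] at h01 h10
    exact ⟨h01, h10, hinj (mul_left_cancel₀ hne (by rw [h00, h11]; ring))⟩

lemma orderOf_mk_eq {X : SL(2, F)} {μ : L} (hμ : μ ≠ 0) (hμ1 : μ ^ 2 ≠ 1)
    (htr : algebraMap F L (X 0 0 + X 1 1) = μ + μ⁻¹) :
    orderOf (QuotientGroup.mk X : PSL2 F) = orderOf (μ ^ 2) := by
  rw [orderOf_eq_orderOf_iff]
  intro n
  rw [← pow_mem_center_iff hμ hμ1 htr, ← QuotientGroup.eq_one_iff]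
  rfl

lemma orderOf_eq_of_trace {X : SL(2, F)} {μ : L} (hμ : μ ≠ 0) (hμ1 : μ ^ 2 ≠ 1)
    (htr : algebraMap F L (X 0 0 + X 1 1) = μ + μ⁻¹) : orderOf X = orderOf μ := by
  have hinj := FaithfulSMul.algebraMap_injective F L
  rw [orderOf_eq_orderOf_iff]
  intro k
  have hne : μ - μ⁻¹ ≠ 0 := by
    intro h
    field_simp at h
    exact hμ1 (by linear_combination h)
  have key (h2 : (μ ^ 2) ^ k = 1) : algebraMap F L ((X ^ k) 0 0) = μ ^ k := by
    have h := congrFun₂ (sub_smul_map_pow (mul_inv_cancel₀ hμ) htr k) 0 0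
    have h3 : (μ⁻¹) ^ k = μ ^ k := by
      rw [inv_pow]
      exact inv_eq_of_mul_eq_one_right (by rw [← pow_add, ← two_mul, pow_mul, h2])
    rw [h3] at h
    generalize X ^ k = Y at h ⊢
    simp at h
    exact mul_left_cancel₀ hne (by rw [h]; ring)
  constructor
  · intro h
    have hc := (pow_mem_center_iff hμ hμ1 htr k).1 (h ▸ Subgroup.one_mem _)
    rw [← key hc, h]
    simp
  · intro h
    have h2 : (μ ^ 2) ^ k = 1 := by rw [← pow_mul, mul_comm, pow_mul, h, one_pow]
    have h00 : (X ^ k) 0 0 = 1 := hinj (by rw [key h2, h, map_one])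
    obtain ⟨a, b, c⟩ := (mem_center_fin_two_iff _).1 ((pow_mem_center_iff hμ hμ1 htr k).2 h2)
    rw [h00] at c
    generalize X ^ k = Y at *
    ext i j
    fin_cases i <;> fin_cases j <;> simp [a, b, ← c, h00]

end Order

end Matrix.SpecialLinearGroup

section Beauville

open Matrix.SpecialLinearGroup MatrixGroups

lemma eq_one_of_mem_conjPowers {G : Type*} [Group G] {a x : G} {n : ℕ} (ha : orderOf a = n)
    (hx : x ∈ conjPowers a) : x ^ n = 1 := by
  obtain ⟨g, j, rfl⟩ := hx
  rw [conj_pow, ← pow_mul, mul_comm, pow_mul, ← ha, pow_orderOf_eq_one]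
  simp

lemma pow_eq_one_of_mem_sigma3 {G : Type*} [Group G] {a b c x : G} {n : ℕ} (ha : orderOf a = n)
    (hb : orderOf b = n) (hc : orderOf c = n) (hx : x ∈ sigma3 a b c) : x ^ n = 1 := by
  rcases hx with (hx | hx) | hx
  · exact eq_one_of_mem_conjPowers ha hx
  · exact eq_one_of_mem_conjPowers hb hx
  · exact eq_one_of_mem_conjPowers hc hx

lemma one_mem_sigma3 {G : Type*} [Group G] (a b c : G) : 1 ∈ sigma3 a b c :=
  Or.inl (Or.inl ⟨1, 0, by simp⟩)

/-- Two generating triples of coprime constant orders form an unmixed Beauville structure. -/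
lemma HasBeauvilleOfType.of_coprime {G : Type*} [Group G] {m n : ℕ} (hmn : m.Coprime n)
    {a₁ b₁ a₂ b₂ : G} (h₁ : Subgroup.closure {a₁, b₁} = ⊤) (h₂ : Subgroup.closure {a₂, b₂} = ⊤)
    (ha₁ : orderOf a₁ = m) (hb₁ : orderOf b₁ = m) (hc₁ : orderOf (a₁ * b₁) = m)
    (ha₂ : orderOf a₂ = n) (hb₂ : orderOf b₂ = n) (hc₂ : orderOf (a₂ * b₂) = n) :
    HasBeauvilleOfType G m m m n n n := by
  rw [← orderOf_inv] at hc₁ hc₂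
  refine ⟨a₁, b₁, (a₁ * b₁)⁻¹, a₂, b₂, (a₂ * b₂)⁻¹, ⟨by simp, by simp, h₁, h₂, ?_⟩, ha₁, hb₁, hc₁,
    ha₂, hb₂, hc₂⟩
  refine Set.Subset.antisymm (fun x hx ↦ ?_) ?_
  · have e1 := pow_eq_one_of_mem_sigma3 ha₁ hb₁ hc₁ hx.1
    have e2 := pow_eq_one_of_mem_sigma3 ha₂ hb₂ hc₂ hx.2
    have := Nat.dvd_gcd (orderOf_dvd_of_pow_eq_one e1) (orderOf_dvd_of_pow_eq_one e2)
    rw [hmn.gcd_eq_one, Nat.dvd_one, orderOf_eq_one_iff] at this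
    exact this
  · rintro x rfl
    exact ⟨one_mem_sigma3 _ _ _, one_mem_sigma3 _ _ _⟩

lemma Nat.coprime_half_sub_half_add {q : ℕ} (hq : 1 < q) :
    ((q - 1) / Nat.gcd 2 (q - 1)).Coprime ((q + 1) / Nat.gcd 2 (q - 1)) := by
  rcases Nat.even_or_odd' (q - 1) with ⟨k, hk | hk⟩
  · have : Nat.gcd 2 (q - 1) = 2 := by rw [hk]; simp
    rw [this, show (q + 1) / 2 = (q - 1) / 2 + 1 by omega]
    simp
  · have : Nat.gcd 2 (q - 1) = 1 := by rw [hk]; simp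
    rw [this, show (q + 1) / 1 = 2 * (k + 1) + 1 by omega, show (q - 1) / 1 = 2 * k + 1 by omega]
    rw [show 2 * (k + 1) + 1 = 2 + (2 * k + 1) by ring, Nat.coprime_add_self_right]
    simp

lemma orderOf_neg_sq {L : Type*} [Field L] {l : L} {n : ℕ} (hl : orderOf l = n) :
    orderOf ((-l) ^ 2) = n / Nat.gcd 2 n := by
  rw [neg_sq, orderOf_pow' _ two_ne_zero, hl, Nat.gcd_comm]

variable {F : Type*} [Field F]

/-- Elements of `PSL₂(F)` generate as soon as every subgroup of `SL(2, F)` containing the center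
and lifts of them is everything. -/
lemma closure_mk_pair_eq_top {A B : SL(2, F)}
    (h : ∀ H : Subgroup SL(2, F), Subgroup.center SL(2, F) ≤ H → A ∈ H → B ∈ H → H = ⊤) :
    Subgroup.closure {(QuotientGroup.mk A : PSL2 F), QuotientGroup.mk B} = ⊤ := by
  have := h ((Subgroup.closure {(QuotientGroup.mk A : PSL2 F), QuotientGroup.mk B}).comap
    (QuotientGroup.mk' _)) ?_ (Subgroup.subset_closure (by simp))
      (Subgroup.subset_closure (by simp))
  · rw [← Subgroup.comap_top (QuotientGroup.mk' (Subgroup.center SL(2, F)))] at this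
    exact Subgroup.comap_injective (QuotientGroup.mk'_surjective _) this
  · intro z hz
    rw [Subgroup.mem_comap, QuotientGroup.mk'_apply, (QuotientGroup.eq_one_iff z).2 hz]
    exact Subgroup.one_mem _

lemma exists_pair_of_trace {L : Type*} [Field L] [Algebra F L] {l : L} (hl : l ≠ 0)
    (hl2 : l ^ 2 ≠ 1) {A B : SL(2, F)}
    (hA : algebraMap F L (A 0 0 + A 1 1) = -l + (-l)⁻¹)
    (hB : algebraMap F L (B 0 0 + B 1 1) = -l + (-l)⁻¹)
    (hAB : algebraMap F L ((A * B) 0 0 + (A * B) 1 1) = -l + (-l)⁻¹)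
    (h : ∀ H : Subgroup SL(2, F), Subgroup.center SL(2, F) ≤ H → A ∈ H → B ∈ H → H = ⊤) :
    ∃ a b : PSL2 F, Subgroup.closure {a, b} = ⊤ ∧ orderOf a = orderOf l / Nat.gcd 2 (orderOf l) ∧
      orderOf b = orderOf l / Nat.gcd 2 (orderOf l) ∧
      orderOf (a * b) = orderOf l / Nat.gcd 2 (orderOf l) := by
  have hl0 : -l ≠ 0 := neg_ne_zero.2 hl
  have hl1 : (-l) ^ 2 ≠ 1 := by rwa [neg_sq]
  rw [← orderOf_neg_sq rfl]
  exact ⟨QuotientGroup.mk A, QuotientGroup.mk B, closure_mk_pair_eq_top h, orderOf_mk_eq hl0 hl1 hA,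
    orderOf_mk_eq hl0 hl1 hB, orderOf_mk_eq hl0 hl1 hAB⟩

lemma mem_of_center_le {H : Subgroup SL(2, F)} (hH : Subgroup.center SL(2, F) ≤ H)
    {A : SL(2, F)} (hA : A ∈ H) : -A ∈ H := by
  rw [← neg_one_mul]
  refine H.mul_mem (hH ((mem_center_fin_two_iff _).2 ?_)) hA
  simp

/-- A generating pair of `PSL₂(q)` with constant order `(q - 1) / gcd(2, q - 1)`. -/
lemma exists_split_pair [Finite F] (hq : 7 < Nat.card F) (hpp : IsPrimePow (Nat.card F)) :
    ∃ a b : PSL2 F, Subgroup.closure {a, b} = ⊤ ∧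
      orderOf a = (Nat.card F - 1) / Nat.gcd 2 (Nat.card F - 1) ∧
      orderOf b = (Nat.card F - 1) / Nat.gcd 2 (Nat.card F - 1) ∧
      orderOf (a * b) = (Nat.card F - 1) / Nat.gcd 2 (Nat.card F - 1) := by
  obtain ⟨l, hl, hl0⟩ : ∃ l : F, orderOf l = Nat.card F - 1 ∧ l ≠ 0 := by
    obtain ⟨l, hl⟩ := IsCyclic.exists_generator (α := Fˣ)
    refine ⟨l, ?_, l.ne_zero⟩
    rw [orderOf_units, orderOf_eq_card_of_forall_mem_zpowers hl, Nat.card_units]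
  have hpow {n : ℕ} (hn : 0 < n) (hn' : n < Nat.card F - 1) : l ^ n ≠ 1 :=
    pow_ne_one_of_lt_orderOf hn.ne' (hl ▸ hn')
  have hl1 : l - 1 ≠ 0 := sub_ne_zero.2 (by simpa using hpow (n := 1) (by norm_num) (by omega))
  set a : F := (l ^ 2 + 1) / (l * (l - 1)) with ha
  set d : F := -(l ^ 2 + 1) / (l - 1) with hd
  let B : SL(2, F) := ⟨!![a, a * d - 1; 1, d], by simp [Matrix.det_fin_two]⟩
  rw [← hl]
  refine exists_pair_of_trace (A := diag2 (-l) (neg_ne_zero.2 hl0)) (B := B) hl0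
    (hpow (n := 2) (by norm_num) (by omega)) ?_ ?_ ?_ fun H hH hA hB ↦ ?_
  · simp [diag2_coe']
  · simp [B, ha, hd]
    field_simp
    ring
  · rw [coe_mul, diag2_coe']
    simp [B, ha, hd]
    field_simp
    ring
  · refine eq_top_of_split_torus hq hpp hl0 hl ?_ hB (by simp [B]) (by simp [B, ha])
      (by simp [B, hd])
    convert mem_of_center_le hH hA using 1
    apply Subtype.ext
    rw [coe_neg, diag2_coe', diag2_coe']
    simp

end Beauville

section NormOne

variable {F L : Type*} [Field F] [Fintype F] [Field L] [Algebra F L]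

open FiniteField

lemma exists_algebraMap_eq_of_frobenius {x : L} (hx : frobeniusAlgHom F L x = x) :
    ∃ y : F, algebraMap F L y = x := by
  classical
  have hinj := FaithfulSMul.algebraMap_injective F L
  have h0 : (Polynomial.X ^ Fintype.card F - Polynomial.X : Polynomial L) ≠ 0 :=
    X_pow_card_sub_X_ne_zero L Fintype.one_lt_card
  by_contra! h
  have hsub : insert x (Finset.univ.image (algebraMap F L)) ⊆
      (Polynomial.X ^ Fintype.card F - Polynomial.X : Polynomial L).roots.toFinset := by
    intro y hy
    rw [Multiset.mem_toFinset, Polynomial.mem_roots h0, Polynomial.IsRoot.def]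
    rcases Finset.mem_insert.1 hy with rfl | hy
    · simpa [sub_eq_zero] using hx
    · obtain ⟨z, -, rfl⟩ := Finset.mem_image.1 hy
      simp [← map_pow, FiniteField.pow_card]
  have h1 := Finset.card_le_card hsub
  rw [Finset.card_insert_of_notMem (by simpa using h), Finset.card_image_of_injective _ hinj,
    Finset.card_univ] at h1
  have h2 := (Multiset.toFinset_card_le _).trans (Polynomial.card_roots'
    (Polynomial.X ^ Fintype.card F - Polynomial.X : Polynomial L))
  rw [X_pow_card_sub_X_natDegree_eq L Fintype.one_lt_card] at h2
  omega

lemma exists_orderOf_eq_card_add_one [IsAlgClosed L] : ∃ l : L, orderOf l = Fintype.card F + 1 := by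
  have : NeZero ((Fintype.card F + 1 : ℕ) : L) := ⟨by
    rw [← map_natCast (algebraMap F L)]
    simp⟩
  obtain ⟨l, hl⟩ := HasEnoughRootsOfUnity.exists_primitiveRoot L (Fintype.card F + 1)
  exact ⟨l, hl.eq_orderOf.symm⟩

lemma exists_algebraMap_eq_add_inv {μ : L} (hφ : frobeniusAlgHom F L μ = μ⁻¹) :
    ∃ τ : F, algebraMap F L τ = μ + μ⁻¹ :=
  exists_algebraMap_eq_of_frobenius (by rw [map_add, map_inv₀, hφ, inv_inv, add_comm])

lemma exists_sq_sub_add_sq_eq [IsAlgClosed L] {μ : L} (hφ : frobeniusAlgHom F L μ = μ⁻¹)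
    (hμ : μ ≠ 0)
    (hμ2 : μ ^ 2 ≠ 1) {τ : F} (hτ : algebraMap F L τ = μ + μ⁻¹) (c : F) :
    ∃ x y : F, x ^ 2 - τ * x * y + y ^ 2 = c := by
  have hinj := FaithfulSMul.algebraMap_injective F L
  obtain ⟨v, hv⟩ := IsAlgClosed.exists_pow_nat_eq (algebraMap F L c)
    (Nat.succ_pos (Fintype.card F))
  set φ := frobeniusAlgHom F L
  have hv' : v * φ v = algebraMap F L c := by rw [← hv, pow_succ']; rfl
  have hvv : φ (φ v) = v := by
    by_cases h0 : φ v = 0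
    · rw [(map_eq_zero φ).1 h0, map_zero, map_zero]
    · have := congrArg φ hv'
      rw [map_mul, AlgHom.commutes, ← hv', mul_comm v] at this
      exact mul_left_cancel₀ h0 this
  have hne : μ - μ⁻¹ ≠ 0 := Matrix.SpecialLinearGroup.sub_inv_ne_zero_of_sq_ne_one hμ hμ2
  obtain ⟨y, hy⟩ : ∃ y : F, algebraMap F L y = (φ v - v) / (μ - μ⁻¹) := by
    refine exists_algebraMap_eq_of_frobenius ?_
    change φ _ = _
    rw [map_div₀, map_sub, map_sub, hvv, map_inv₀, hφ, inv_inv, ← neg_sub, ← neg_sub μ,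
      neg_div_neg_eq]
  obtain ⟨x, hx⟩ : ∃ x : F, algebraMap F L x = v + μ * ((φ v - v) / (μ - μ⁻¹)) := by
    refine exists_algebraMap_eq_of_frobenius ?_
    change φ _ = _
    rw [← hy, map_add, map_mul, AlgHom.commutes, hφ, hy]
    linear_combination (-1 : L) * div_mul_cancel₀ (φ v - v) hne
  refine ⟨x, y, hinj ?_⟩
  have h1 : algebraMap F L x - μ * algebraMap F L y = v := by rw [hx, hy]; ring
  have h2 : algebraMap F L x - μ⁻¹ * algebraMap F L y = φ v := by
    rw [hx, hy]
    linear_combination div_mul_cancel₀ (φ v - v) hne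
  simp only [map_add, map_sub, map_mul, map_pow]
  rw [← hv', ← h2, ← h1, hτ]
  linear_combination -(algebraMap F L y) ^ 2 * mul_inv_cancel₀ hμ

lemma exists_det_eq_one [IsAlgClosed L] {μ : L} (hφ : frobeniusAlgHom F L μ = μ⁻¹) (hμ : μ ≠ 0)
    (hμ2 : μ ^ 2 ≠ 1) {τ : F} (hτ : algebraMap F L τ = μ + μ⁻¹) (hτ2 : 2 + τ ≠ 0) :
    ∃ z w : F, (τ - w) * w - (τ - τ * w + z) * z = 1 := by
  obtain ⟨x, y, h⟩ := exists_sq_sub_add_sq_eq hφ hμ hμ2 hτ (τ * (τ / (2 + τ)) - 1)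
  refine ⟨-(τ / (2 + τ)) + y, τ / (2 + τ) + x, ?_⟩
  have : τ / (2 + τ) * (2 + τ) = τ := div_mul_cancel₀ _ hτ2
  generalize τ / (2 + τ) = s at *
  linear_combination -h + (y - x - s) * this

end NormOne

section CentralizerAction

variable {G : Type*} [Group G]

/-- A centralizer acts by conjugation on the nontrivial part of a conjugacy class. -/
abbrev centralizerConjAction (a : G) : MulAction (Subgroup.centralizer {a})
    {x : G // IsConj a x ∧ x ≠ a ∧ x ≠ a⁻¹} where
  smul c x := ⟨(c : G) * x * (c : G)⁻¹, by
    have hc : Commute (c : G) a := Subgroup.mem_centralizer_singleton_iff.1 c.2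
    refine ⟨x.2.1.trans (isConj_iff.2 ⟨c, rfl⟩), fun h ↦ x.2.2.1 ?_, fun h ↦ x.2.2.2 ?_⟩
    · rw [mul_inv_eq_iff_eq_mul, ← hc.eq] at h
      exact mul_left_cancel h
    · rw [mul_inv_eq_iff_eq_mul, ← hc.inv_right.eq] at h
      exact mul_left_cancel h⟩
  one_smul x := Subtype.ext (by change (1 : G) * x * 1⁻¹ = x; simp)
  mul_smul c d x := Subtype.ext (by
    change (c * d : G) * x * (c * d : G)⁻¹ = c * (d * x * (d : G)⁻¹) * (c : G)⁻¹
    group)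

lemma card_centralizer_mul_card_isConj (a : G) :
    Nat.card (Subgroup.centralizer {a}) * Nat.card {x : G // IsConj a x} = Nat.card G := by
  have h1 := Subgroup.nat_card_centralizer_nat_card_stabilizer a
  have h2 : Nat.card {x : G // IsConj a x} = (MulAction.orbit (ConjAct G) a).ncard :=
    Nat.card_congr (Equiv.subtypeEquivRight fun x ↦ by
      rw [ConjAct.mem_orbit_conjAct, isConj_comm])
  rw [h1, h2, ← MulAction.index_stabilizer, Subgroup.card_mul_index]
  rfl

lemma exists_card_isConj_eq [Finite G] {a b : G} {Z : Subgroup G} (hZ : Z ≤ Subgroup.center G)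
    (hb : b * a * b⁻¹ ≠ a) (hb' : b * a * b⁻¹ ≠ a⁻¹)
    (hstab : ∀ x c : G, IsConj a x → x ≠ a → x ≠ a⁻¹ → c * a = a * c → c * x = x * c → c ∈ Z) :
    ∃ N j ε : ℕ, (ε = 1 ∨ ε = 2) ∧ 0 < j ∧
      Nat.card (Subgroup.centralizer {a}) * N = Nat.card G ∧
      N = ε + j * (Nat.card (Subgroup.centralizer {a}) / Nat.card Z) := by
  classical
  have := Fintype.ofFinite G
  let S := {x : G // IsConj a x ∧ x ≠ a ∧ x ≠ a⁻¹}
  let _ := centralizerConjAction a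
  have hcard := MulAction.card_eq_sum_card_group_div_card_stabilizer (Subgroup.centralizer {a}) S
  have hZC : Z ≤ Subgroup.centralizer {a} := hZ.trans (Subgroup.center_le_centralizer _)
  have hst (x : S) : Fintype.card (MulAction.stabilizer (Subgroup.centralizer {a}) x) =
      Nat.card Z := by
    rw [← Nat.card_eq_fintype_card, ← Nat.card_congr (Subgroup.subgroupOfEquivOfLe hZC).toEquiv]
    congr 2
    ext c
    have hc : (c : G) * a = a * c := Subgroup.mem_centralizer_singleton_iff.1 c.2
    have hx : c • x = x ↔ (c : G) * x = x * c := by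
      rw [Subtype.ext_iff, ← mul_inv_eq_iff_eq_mul]
      rfl
    rw [MulAction.mem_stabilizer_iff, hx, Subgroup.mem_subgroupOf]
    exact ⟨fun h ↦ hstab _ _ x.2.1 x.2.2.1 x.2.2.2 hc h,
      fun h ↦ (Subgroup.mem_center_iff.1 (hZ h) x).symm⟩
  simp_rw [hst, Finset.sum_const, smul_eq_mul, ← Nat.card_eq_fintype_card] at hcard
  let T : Finset G := {x | IsConj a x ∧ (x = a ∨ x = a⁻¹)}
  have hsplit : Nat.card {x : G // IsConj a x} = T.card + Nat.card S := by
    simp only [S, Nat.card_eq_fintype_card, Fintype.card_subtype, T]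
    rw [← Finset.card_union_of_disjoint]
    · congr 1
      ext x
      simp
      tauto
    · rw [Finset.disjoint_filter]
      tauto
  have hT1 : 0 < T.card := Finset.card_pos.2
    ⟨a, Finset.mem_filter.2 ⟨Finset.mem_univ _, IsConj.refl a, Or.inl rfl⟩⟩
  have hT2 : T.card ≤ 2 := (Finset.card_le_card (t := {a, a⁻¹}) fun x ↦ by
    simp +contextual [T]).trans Finset.card_le_two
  refine ⟨_, _, T.card, by omega, Finset.card_pos.2 ?_, card_centralizer_mul_card_isConj a,
    hsplit.trans (congrArg _ hcard)⟩
  exact ⟨Quotient.mk _ ⟨b * a * b⁻¹, isConj_iff.2 ⟨b, rfl⟩, hb, hb'⟩, Finset.mem_univ _⟩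

end CentralizerAction

namespace Matrix.SpecialLinearGroup

open scoped MatrixGroups
open FiniteField

section Companion

variable {F L : Type*} [Field F] [Field L] [Algebra F L]

/-- The companion matrix of `X² - τ X + 1`. -/
def companion (τ : F) : SL(2, F) := ⟨!![0, -1; 1, τ], by simp [Matrix.det_fin_two]⟩

lemma companion_coe (τ : F) : (companion τ : Matrix (Fin 2) (Fin 2) F) = !![0, -1; 1, τ] := rfl

lemma mul_companion_coe (c : SL(2, F)) (τ : F) :
    ((c * companion τ : SL(2, F)) : Matrix (Fin 2) (Fin 2) F) =
      !![c 0 1, -c 0 0 + c 0 1 * τ; c 1 1, -c 1 0 + c 1 1 * τ] := by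
  rw [coe_mul, companion_coe, Matrix.eta_fin_two (c : Matrix (Fin 2) (Fin 2) F)]
  simp

lemma companion_mul_coe (c : SL(2, F)) (τ : F) :
    ((companion τ * c : SL(2, F)) : Matrix (Fin 2) (Fin 2) F) =
      !![-c 1 0, -c 1 1; c 0 0 + τ * c 1 0, c 0 1 + τ * c 1 1] := by
  rw [coe_mul, companion_coe, Matrix.eta_fin_two (c : Matrix (Fin 2) (Fin 2) F)]
  simp

lemma commute_companion {c : SL(2, F)} {τ : F} (h : c * companion τ = companion τ * c) :
    c 0 1 = -c 1 0 ∧ c 1 1 = c 0 0 + τ * c 1 0 := by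
  have h' := congrArg (fun X : SL(2, F) ↦ (X : Matrix (Fin 2) (Fin 2) F)) h
  simp only [mul_companion_coe, companion_mul_coe] at h'
  exact ⟨congrFun₂ h' 0 0, congrFun₂ h' 1 0⟩

lemma mul_companion_eq_of_commute {c X : SL(2, F)} {τ : F}
    (hc : c * companion τ = companion τ * c) (hc0 : c 1 0 ≠ 0) (hX : c * X = X * c) :
    X * companion τ = companion τ * X := by
  obtain ⟨h1, h2⟩ := commute_companion hc
  have h' := congrArg (fun X : SL(2, F) ↦ (X : Matrix (Fin 2) (Fin 2) F)) hX
  simp only [coe_mul] at h'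
  have e00 := congrFun₂ h' 0 0
  have e01 := congrFun₂ h' 0 1
  have e10 := congrFun₂ h' 1 0
  have e11 := congrFun₂ h' 1 1
  simp only [Matrix.mul_apply, Fin.sum_univ_two, h1, h2] at e00 e01 e10 e11
  apply Subtype.ext
  rw [mul_companion_coe, companion_mul_coe]
  ext i j
  fin_cases i <;> fin_cases j <;> simp <;> refine mul_left_cancel₀ hc0 ?_
  · linear_combination -e00
  · linear_combination -e01
  · linear_combination -e10
  · linear_combination -e11

variable {τ : F} {μ : L}

lemma eq_of_commute_companion (hμ2 : μ ∉ Set.range (algebraMap F L)) {c d : SL(2, F)}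
    (hc : c * companion τ = companion τ * c) (hd : d * companion τ = companion τ * d)
    (h : algebraMap F L (c 0 0) + algebraMap F L (c 1 0) * μ =
      algebraMap F L (d 0 0) + algebraMap F L (d 1 0) * μ) : c = d := by
  have hinj := FaithfulSMul.algebraMap_injective F L
  obtain ⟨c1, c2⟩ := commute_companion hc
  obtain ⟨d1, d2⟩ := commute_companion hd
  have h10 : c 1 0 = d 1 0 := by
    by_contra hne
    have hne' : algebraMap F L (c 1 0 - d 1 0) ≠ 0 := by
      rw [Ne, map_eq_zero, sub_eq_zero]
      exact hne
    refine hμ2 ⟨(d 0 0 - c 0 0) / (c 1 0 - d 1 0), ?_⟩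
    rw [map_div₀, div_eq_iff hne', map_sub, map_sub]
    linear_combination -h
  have h00 : c 0 0 = d 0 0 := hinj (by rw [h10] at h; exact add_right_cancel h)
  ext i j
  fin_cases i <;> fin_cases j <;> simp [c1, c2, d1, d2, h10, h00]

lemma norm_of_commute_companion (hμ : μ ≠ 0) (hτ : algebraMap F L τ = μ + μ⁻¹) {c : SL(2, F)}
    (hc : c * companion τ = companion τ * c) :
    (algebraMap F L (c 0 0) + algebraMap F L (c 1 0) * μ) *
      (algebraMap F L (c 0 0) + algebraMap F L (c 1 0) * μ⁻¹) = 1 := by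
  obtain ⟨c1, c2⟩ := commute_companion hc
  have hd := congrArg (algebraMap F L) (fin_two_det c)
  rw [c1, c2] at hd
  simp only [map_sub, map_mul, map_add, map_neg, map_one, hτ] at hd
  linear_combination hd + algebraMap F L (c 1 0) ^ 2 * mul_inv_cancel₀ hμ

lemma mem_center_of_commute_companion (hμ : μ ≠ 0) (hμ2 : μ ∉ Set.range (algebraMap F L))
    (hτ : algebraMap F L τ = μ + μ⁻¹) {c X : SL(2, F)} (hX : X 0 0 + X 1 1 = τ)
    (hX1 : X ≠ companion τ) (hX2 : X ≠ (companion τ)⁻¹) (hc : c * companion τ = companion τ * c)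
    (hcX : c * X = X * c) : c ∈ Subgroup.center SL(2, F) := by
  obtain ⟨c1, c2⟩ := commute_companion hc
  by_cases hc0 : c 1 0 = 0
  · rw [mem_center_fin_two_iff]
    exact ⟨by simp [c1, hc0], hc0, by simp [c2, hc0]⟩
  exfalso
  have hXA := mul_companion_eq_of_commute hc hc0 hcX
  obtain ⟨x1, x2⟩ := commute_companion hXA
  have hn := norm_of_commute_companion hμ hτ hXA
  rw [x2] at hX
  have hX' := congrArg (algebraMap F L) hX
  simp only [map_add, map_mul, hτ] at hX'
  set x := algebraMap F L (X 0 0) + algebraMap F L (X 1 0) * μ with hx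
  have hx2 : algebraMap F L (X 0 0) + algebraMap F L (X 1 0) * μ⁻¹ = μ + μ⁻¹ - x := by
    rw [hx]
    linear_combination hX'
  rw [hx2] at hn
  have : (x - μ) * (x - μ⁻¹) = 0 := by linear_combination -hn + mul_inv_cancel₀ hμ
  rcases mul_eq_zero.1 this with h | h
  · refine hX1 (eq_of_commute_companion hμ2 hXA rfl ?_)
    rw [← hx, sub_eq_zero.1 h]
    simp [companion_coe]
  · refine hX2 (eq_of_commute_companion hμ2 hXA (by simp) ?_)
    rw [← hx, sub_eq_zero.1 h, coe_inv, companion_coe, Matrix.adjugate_fin_two]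
    simp [hτ]

lemma neg_companion_pow_apply (hμ : μ ≠ 0) (hτ : algebraMap F L τ = μ + μ⁻¹) (k : ℕ) :
    algebraMap F L (((-companion τ) ^ k : SL(2, F)) 0 0) +
      algebraMap F L (((-companion τ) ^ k : SL(2, F)) 1 0) * μ = (-μ) ^ k := by
  induction k with
  | zero => simp
  | succ k ih =>
    rw [pow_succ', pow_succ', ← ih, neg_mul, coe_neg, companion_mul_coe]
    generalize (-companion τ) ^ k = X
    simp [hτ]
    linear_combination -algebraMap F L (X 1 0) * mul_inv_cancel₀ hμ

lemma mem_zpowers_of_commute_companion [Fintype F] (hφ : frobeniusAlgHom F L μ = μ⁻¹) (hμ : μ ≠ 0)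
    (hμ2 : μ ∉ Set.range (algebraMap F L)) (hτ : algebraMap F L τ = μ + μ⁻¹)
    (hord : orderOf (-μ) = Fintype.card F + 1) {c : SL(2, F)}
    (hc : c * companion τ = companion τ * c) : c ∈ Subgroup.zpowers (-companion τ) := by
  have hn := norm_of_commute_companion hμ hτ hc
  have hx : (algebraMap F L (c 0 0) + algebraMap F L (c 1 0) * μ) ^ (Fintype.card F + 1) = 1 := by
    rw [← hn, pow_succ']
    congr 1
    change frobeniusAlgHom F L _ = _
    rw [map_add, map_mul, AlgHom.commutes, AlgHom.commutes, hφ]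
  obtain ⟨k, -, hk⟩ := (hord ▸ IsPrimitiveRoot.orderOf (-μ)).eq_pow_of_pow_eq_one hx
  refine ⟨k, ?_⟩
  change (-companion τ) ^ (k : ℤ) = c
  rw [zpow_natCast]
  refine eq_of_commute_companion hμ2 ?_ hc (by rw [neg_companion_pow_apply hμ hτ, hk])
  exact (((Commute.refl (companion τ)).neg_left).pow_left k).eq

end Companion

section Card

variable {F L : Type*} [Field F] [Fintype F] [Field L] [Algebra F L]

variable (F) in
lemma card_SL_two : Nat.card SL(2, F) =
    (Fintype.card F + 1) * (Fintype.card F * (Fintype.card F - 1)) := by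
  classical
  have h1 := Subgroup.card_mul_index (GeneralLinearGroup.det (n := Fin 2) (R := F)).ker
  rw [Subgroup.index_ker, MonoidHom.range_eq_top.2 GeneralLinearGroup.det_surjective,
    Nat.card_congr Subgroup.topEquiv.toEquiv, Nat.card_eq_fintype_card (α := Fˣ),
    Fintype.card_units, card_GL_field, Fin.prod_univ_two] at h1
  have h2 : Nat.card SL(2, F) = Nat.card (GeneralLinearGroup.det (n := Fin 2) (R := F)).ker := by
    refine Nat.card_congr (Equiv.ofBijective (fun g ↦ ⟨toGL g, ?_⟩) ⟨fun g h hgh ↦ ?_, ?_⟩)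
    · rw [MonoidHom.mem_ker]
      ext
      simp
    · exact toGL_injective (congrArg Subtype.val hgh)
    · rintro ⟨g, hg⟩
      refine ⟨⟨g, ?_⟩, ?_⟩
      · rw [MonoidHom.mem_ker] at hg
        simpa using congrArg Units.val hg
      · ext
        rfl
  have hq := Fintype.one_lt_card (α := F)
  refine Nat.eq_of_mul_eq_mul_right (Nat.sub_pos_of_lt hq) ?_
  rw [h2, h1]
  obtain ⟨k, hk⟩ := Nat.exists_eq_add_of_lt hq
  rw [hk]
  simp
  rw [show (1 + k + 1) ^ 2 - 1 = (1 + k + 1 + 1) * (k + 1) by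
      rw [Nat.sub_eq_iff_eq_add (Nat.one_le_pow _ _ (by omega))]; ring,
    show (1 + k + 1) ^ 2 - (1 + k + 1) = (1 + k + 1) * (k + 1) by
      rw [Nat.sub_eq_iff_eq_add (Nat.le_self_pow two_ne_zero _)]; ring]
  rw [show 1 + k = k + 1 by ring]
  ring

variable (F) in
lemma card_center_SL_two :
    Nat.card (Subgroup.center SL(2, F)) = Nat.gcd 2 (Fintype.card F - 1) := by
  have h : Subgroup.center SL(2, F) = Subgroup.zpowers (-1 : SL(2, F)) := by
    ext X
    rw [mem_center_fin_two_iff]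
    constructor
    · rintro ⟨h1, h2, h3⟩
      have hd := fin_two_det X
      rw [h1, ← h3, zero_mul, sub_zero, mul_self_eq_one_iff] at hd
      rcases hd with hd | hd
      · convert Subgroup.one_mem _
        ext i j
        fin_cases i <;> fin_cases j <;> simp [h1, h2, ← h3, hd]
      · convert Subgroup.mem_zpowers (-1 : SL(2, F))
        ext i j
        fin_cases i <;> fin_cases j <;> simp [h1, h2, ← h3, hd]
    · rintro ⟨k, rfl⟩
      rcases Int.even_or_odd k with hk | hk
      · simp [hk.neg_one_zpow]
      · simp [hk.neg_one_zpow]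
  rw [h, Nat.card_zpowers]
  have hq := Fintype.one_lt_card (α := F)
  by_cases h2 : ringChar F = 2
  · have : (-1 : SL(2, F)) = 1 := by
      have h1 : (-1 : F) = 1 := by
        have := CharP.cast_eq_zero F (ringChar F)
        rw [h2] at this
        push_cast at this
        linear_combination -this
      ext i j
      fin_cases i <;> fin_cases j <;> simp [h1]
    rw [this, orderOf_one]
    have := FiniteField.even_card_of_char_two h2
    obtain ⟨k, hk⟩ : ∃ k, Fintype.card F - 1 = 2 * k + 1 := ⟨Fintype.card F / 2 - 1, by omega⟩
    simp [hk]
  · rw [orderOf_eq_prime (p := 2) (by simp)]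
    · have := FiniteField.odd_card_of_char_ne_two h2
      obtain ⟨k, hk⟩ : ∃ k, Fintype.card F - 1 = 2 * k := ⟨Fintype.card F / 2, by omega⟩
      simp [hk]
    · intro h1
      have := congrFun₂ (congrArg Subtype.val h1) 0 0
      simp at this
      exact Ring.two_ne_zero h2 (by linear_combination -this)

lemma exists_index_eq {μ : L} {τ : F} (hφ : frobeniusAlgHom F L μ = μ⁻¹) (hμ : μ ≠ 0)
    (hμ2 : μ ∉ Set.range (algebraMap F L)) (hτ : algebraMap F L τ = μ + μ⁻¹)
    (hord : orderOf (-μ) = Fintype.card F + 1) {H : Subgroup SL(2, F)}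
    (hZ : Subgroup.center SL(2, F) ≤ H) {B : SL(2, F)} (hA : companion τ ∈ H) (hB : B ∈ H)
    (hBA : B * companion τ * B⁻¹ ≠ companion τ) (hBA' : B * companion τ * B⁻¹ ≠ (companion τ)⁻¹) :
    ∃ N j ε : ℕ, (ε = 1 ∨ ε = 2) ∧ 0 < j ∧ Nat.card H = (Fintype.card F + 1) * N ∧
      N * H.index = Fintype.card F * (Fintype.card F - 1) ∧
      N = ε + j * ((Fintype.card F + 1) / Nat.gcd 2 (Fintype.card F - 1)) := by
  set A := companion τ with hAdef
  have hC : Nat.card (Subgroup.centralizer {(⟨A, hA⟩ : H)}) = Fintype.card F + 1 := by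
    have hA' : -A ∈ H := mem_of_center_le hZ hA
    have : Subgroup.centralizer {(⟨A, hA⟩ : H)} = Subgroup.zpowers ⟨-A, hA'⟩ := by
      ext c
      rw [Subgroup.mem_centralizer_singleton_iff, Subtype.ext_iff]
      constructor
      · intro h
        obtain ⟨k, hk⟩ := mem_zpowers_of_commute_companion hφ hμ hμ2 hτ hord h
        exact ⟨k, Subtype.ext (by simpa using hk)⟩
      · rintro ⟨k, rfl⟩
        simpa using (((Commute.refl A).neg_left).zpow_left k).eq
    rw [this, Nat.card_zpowers, ← Subgroup.orderOf_coe, ← hord]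
    refine orderOf_eq_of_trace (neg_ne_zero.2 hμ) ?_ ?_
    · intro h
      have := orderOf_dvd_of_pow_eq_one h
      have := Nat.le_of_dvd two_pos (hord ▸ this)
      have := Fintype.one_lt_card (α := F)
      omega
    · simp [hAdef, companion_coe, hτ, inv_neg, add_comm]
  have hcen (z : SL(2, F)) (hz : z ∈ Subgroup.center SL(2, F)) (g : SL(2, F)) : g * z = z * g :=
    Subgroup.mem_center_iff.1 hz g
  obtain ⟨N, j, ε, hε, hj, hN, hN'⟩ := exists_card_isConj_eq (a := (⟨A, hA⟩ : H)) (b := ⟨B, hB⟩)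
    (Z := (Subgroup.center SL(2, F)).subgroupOf H)
    (fun z hz ↦ Subgroup.mem_center_iff.2 fun g ↦ Subtype.ext (hcen z hz g))
    (fun h ↦ hBA (congrArg Subtype.val h)) (fun h ↦ hBA' (congrArg Subtype.val h))
    (fun x c hx h1 h2 h3 h4 ↦ by
      refine mem_center_of_commute_companion (X := x) hμ hμ2 hτ ?_ (fun h ↦ h1 (Subtype.ext h))
        (fun h ↦ h2 (Subtype.ext h)) (congrArg Subtype.val h3) (congrArg Subtype.val h4)
      obtain ⟨g, hg⟩ := isConj_iff.1 hx
      rw [← hg, ← Matrix.trace_fin_two]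
      simp only [Subgroup.coe_mul, Subgroup.coe_inv, coe_mul]
      rw [Matrix.trace_mul_cycle, ← coe_mul, inv_mul_cancel, coe_one, one_mul, hAdef,
        Matrix.trace_fin_two]
      simp [companion_coe])
  rw [hC] at hN hN'
  refine ⟨N, j, ε, hε, hj, hN.symm, ?_, ?_⟩
  · have := Subgroup.card_mul_index H
    rw [← hN, card_SL_two, mul_assoc] at this
    exact Nat.eq_of_mul_eq_mul_left (Nat.succ_pos _) this
  · rw [hN', Nat.card_congr (Subgroup.subgroupOfEquivOfLe hZ).toEquiv, card_center_SL_two]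

end Card

end Matrix.SpecialLinearGroup

section IndexArithmetic

lemma index_of_one_mod_odd {n j M : ℤ} (hn : 5 ≤ n) (hj : 1 ≤ j) (hM : 1 ≤ M)
    (h : (1 + j * n) * M = (2 * n - 1) * (2 * n - 2)) :
    M = 2 ∨ (n = 5 ∧ j = 1) ∨ n = 11 ∨ (n = 13 ∧ j = 3) := by
  obtain ⟨m, hm⟩ : ∃ m, m = 4 * n - 6 - j * M := ⟨_, rfl⟩
  have hM' : M = 2 + n * m := by rw [hm]; linear_combination h
  have hm0 : 0 ≤ m := by nlinarith
  rcases hm0.eq_or_lt with rfl | hm1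
  · left; simpa using hM'
  have e : m + 2 * j + j * m * n = 4 * n - 6 := by rw [hM'] at hm; linear_combination hm
  have hjm : j * m ≤ 3 := by nlinarith
  have hj3 : j ≤ 3 := by nlinarith
  have hm3 : m ≤ 3 := by nlinarith
  right
  interval_cases j <;> interval_cases m <;> omega

lemma index_of_two_mod_odd {n j M : ℤ} (hn : 5 ≤ n) (hj : 1 ≤ j) (hM : 1 ≤ M)
    (h : (2 + j * n) * M = (2 * n - 1) * (2 * n - 2)) :
    M = 1 ∨ (n = 5 ∧ j = 2) ∨ n = 8 ∨ n = 11 ∨ (n = 13 ∧ j = 1) ∨ n = 28 := by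
  obtain ⟨m, hm⟩ : ∃ m, m = 4 * n - 6 - j * M := ⟨_, rfl⟩
  have hM' : 2 * M = 2 + n * m := by rw [hm]; linear_combination h
  have hm0 : 0 ≤ m := by nlinarith
  rcases hm0.eq_or_lt with rfl | hm1
  · left; omega
  have e : 2 * m + 2 * j + j * m * n = 8 * n - 12 := by linear_combination 2 * hm - j * hM'
  have hjm : j * m ≤ 7 := by nlinarith
  have hj3 : j ≤ 7 := by nlinarith
  have hm3 : m ≤ 7 := by nlinarith
  right
  interval_cases j <;> interval_cases m <;> omega

lemma index_of_one_mod_even {n j M : ℤ} (hn : 5 ≤ n) (hj : 1 ≤ j) (hM : 1 ≤ M)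
    (h : (1 + j * n) * M = (n - 1) * (n - 2)) : M = 2 := by
  obtain ⟨m, hm⟩ : ∃ m, m = n - 3 - j * M := ⟨_, rfl⟩
  have hM' : M = 2 + n * m := by rw [hm]; linear_combination h
  have hm0 : 0 ≤ m := by nlinarith
  rcases hm0.eq_or_lt with rfl | hm1
  · simpa using hM'
  have e : m + 2 * j + j * m * n = n - 3 := by rw [hM'] at hm; linear_combination hm
  have : 1 ≤ j * m := by nlinarith
  nlinarith

lemma index_of_two_mod_even {n j M : ℤ} (hn : 5 ≤ n) (hj : 1 ≤ j) (hM : 1 ≤ M)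
    (h : (2 + j * n) * M = (n - 1) * (n - 2)) : M = 1 ∨ n = 10 := by
  obtain ⟨m, hm⟩ : ∃ m, m = n - 3 - j * M := ⟨_, rfl⟩
  have hM' : 2 * M = 2 + n * m := by rw [hm]; linear_combination h
  have hm0 : 0 ≤ m := by nlinarith
  rcases hm0.eq_or_lt with rfl | hm1
  · left; omega
  have e : 2 * m + 2 * j + j * m * n = 2 * n - 6 := by linear_combination 2 * hm - j * hM'
  have hjm : j * m ≤ 1 := by nlinarith
  have hj3 : j ≤ 1 := by nlinarith
  have hm3 : m ≤ 1 := by nlinarith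
  right
  interval_cases j; interval_cases m; omega

lemma index_eq_of_isPrimePow {q N M j ε : ℕ} (hq : 7 < q) (hpp : IsPrimePow q)
    (hε : ε = 1 ∨ ε = 2) (hj : 0 < j) (hNM : N * M = q * (q - 1))
    (hN : N = ε + j * ((q + 1) / Nat.gcd 2 (q - 1))) :
    M = 1 ∨ M = 2 ∨ (q = 9 ∧ (N = 6 ∨ N = 12)) ∨ (q = 25 ∧ (N = 40 ∨ N = 15)) := by
  have hM : 0 < M := by
    rcases M.eq_zero_or_pos with rfl | h
    · have : 0 < q * (q - 1) := Nat.mul_pos (by omega) (by omega)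
      omega
    · exact h
  have h15 : q ≠ 15 := by
    rintro rfl
    exact Matrix.SpecialLinearGroup.not_isPrimePow_of_two_primes Nat.prime_three Nat.prime_five
      (by simp) (by simp)
      (by simp) hpp
  have h21 : q ≠ 21 := by
    rintro rfl
    exact Matrix.SpecialLinearGroup.not_isPrimePow_of_two_primes Nat.prime_three Nat.prime_seven
      (by simp) (by simp)
      (by simp) hpp
  have h55 : q ≠ 55 := by
    rintro rfl
    exact Matrix.SpecialLinearGroup.not_isPrimePow_of_two_primes Nat.prime_five Nat.prime_eleven
      (by simp) (by simp)
      (by simp) hpp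
  rcases Nat.even_or_odd' (q - 1) with ⟨k, hk | hk⟩
  · have hg : Nat.gcd 2 (q - 1) = 2 := by rw [hk]; simp
    rw [hg, show (q + 1) / 2 = k + 1 by omega] at hN
    rw [show q - 1 = 2 * k by omega, show q = 2 * k + 1 by omega, hN] at hNM
    zify at hNM
    rcases hε with rfl | rfl
    · have := index_of_one_mod_odd (n := k + 1) (j := j) (M := M) (by omega) (by omega) (by omega)
        (by push_cast at hNM; linear_combination hNM)
      rcases this with h | ⟨h, h'⟩ | h | ⟨h, h'⟩
      · omega
      · obtain rfl : k = 4 := by omega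
        obtain rfl : j = 1 := by omega
        omega
      · omega
      · obtain rfl : k = 12 := by omega
        obtain rfl : j = 3 := by omega
        omega
    · have := index_of_two_mod_odd (n := k + 1) (j := j) (M := M) (by omega) (by omega) (by omega)
        (by push_cast at hNM; linear_combination hNM)
      rcases this with h | ⟨h, h'⟩ | h | h | ⟨h, h'⟩ | h
      · omega
      · obtain rfl : k = 4 := by omega
        obtain rfl : j = 2 := by omega
        omega
      · omega
      · omega
      · obtain rfl : k = 12 := by omega
        obtain rfl : j = 1 := by omega
        omega
      · omega
  · have hg : Nat.gcd 2 (q - 1) = 1 := by rw [hk]; simp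
    rw [hg, Nat.div_one, show q + 1 = 2 * k + 3 by omega] at hN
    rw [show q - 1 = 2 * k + 1 by omega, show q = 2 * k + 2 by omega, hN] at hNM
    zify at hNM
    rcases hε with rfl | rfl
    · have := index_of_one_mod_even (n := 2 * k + 3) (j := j) (M := M) (by omega) (by omega)
        (by omega) (by push_cast at hNM; linear_combination hNM)
      omega
    · have := index_of_two_mod_even (n := 2 * k + 3) (j := j) (M := M) (by omega) (by omega)
        (by omega) (by push_cast at hNM; linear_combination hNM)
      omega

end IndexArithmetic

namespace Matrix.SpecialLinearGroup

open scoped MatrixGroups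

section Exceptional

variable {F : Type*} [Field F]

lemma index_ne_two {a : F} (ha : a ≠ 0) (ha2 : a ^ 2 ≠ 1) (H : Subgroup SL(2, F)) :
    H.index ≠ 2 := by
  intro h
  have hle : commutator SL(2, F) ≤ H := by
    rw [commutator_def, Subgroup.commutator_le]
    intro x _ y _
    simp only [commutatorElement_def, Subgroup.mul_mem_iff_of_index_two h, inv_mem_iff]
    tauto
  rw [SL2.commutator_eq_top ha ha2, top_le_iff] at hle
  rw [hle, Subgroup.index_top] at h
  omega

lemma trace_commutator (X Y : SL(2, F)) :
    (X * Y * X⁻¹ * Y⁻¹) 0 0 + (X * Y * X⁻¹ * Y⁻¹) 1 1 =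
      (X 0 0 + X 1 1) ^ 2 + (Y 0 0 + Y 1 1) ^ 2 + ((X * Y) 0 0 + (X * Y) 1 1) ^ 2 -
        (X 0 0 + X 1 1) * (Y 0 0 + Y 1 1) * ((X * Y) 0 0 + (X * Y) 1 1) - 2 := by
  have hX := fin_two_det X
  have hY := fin_two_det Y
  simp only [coe_mul, coe_inv, Matrix.adjugate_fin_two, Matrix.mul_apply, Fin.sum_univ_two,
    Matrix.of_apply, Matrix.cons_val_zero, Matrix.cons_val_one, Matrix.cons_val',
    Matrix.cons_val_fin_one]
  generalize X 0 0 = a at *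
  generalize X 0 1 = b at *
  generalize X 1 0 = c at *
  generalize X 1 1 = d at *
  generalize Y 0 0 = e at *
  generalize Y 0 1 = f at *
  generalize Y 1 0 = g at *
  generalize Y 1 1 = h at *
  simp
  linear_combination (a + d) ^ 2 * hY + (e + h) ^ 2 * hX - 2 * ((a * d - b * c) * hY + hX)

lemma trace_mul_inv (X Y : SL(2, F)) :
    (X * Y⁻¹) 0 0 + (X * Y⁻¹) 1 1 =
      (X 0 0 + X 1 1) * (Y 0 0 + Y 1 1) - ((X * Y) 0 0 + (X * Y) 1 1) := by
  simp [Matrix.mul_apply, Fin.sum_univ_two, Matrix.adjugate_fin_two]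
  ring

lemma trace_sq_mul (X Y : SL(2, F)) :
    (X * (X * Y)) 0 0 + (X * (X * Y)) 1 1 =
      (X 0 0 + X 1 1) * ((X * Y) 0 0 + (X * Y) 1 1) - (Y 0 0 + Y 1 1) := by
  have hX := fin_two_det X
  simp [Matrix.mul_apply, Fin.sum_univ_two]
  linear_combination -(Y 0 0 + Y 1 1) * hX

lemma exists_conj_eq_diag2 {w : SL(2, F)} {κ : F} (hκ : κ ≠ 0) (hκ2 : κ ^ 2 ≠ 1)
    (htr : w 0 0 + w 1 1 = κ + κ⁻¹) :
    ∃ (g : SL(2, F)) (t : F) (ht : t ≠ 0), t + t⁻¹ = κ + κ⁻¹ ∧ g⁻¹ * w * g = diag2 t ht := by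
  have hd := fin_two_det w
  by_cases hc : w 1 0 = 0
  · rw [hc, mul_zero, sub_zero] at hd
    have ht : w 0 0 ≠ 0 := left_ne_zero_of_mul_eq_one hd
    have h11 : w 1 1 = (w 0 0)⁻¹ := eq_inv_of_mul_eq_one_right hd
    have hne : w 0 0 - w 1 1 ≠ 0 := by
      intro h
      apply sub_inv_ne_zero_of_sq_ne_one hκ hκ2
      rw [← sq_eq_zero_iff]
      linear_combination -4 * mul_inv_cancel₀ hκ + 4 * hd + (w 0 0 - w 1 1) * h -
        (w 0 0 + w 1 1 + κ + κ⁻¹) * htr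
    refine ⟨transvection zero_ne_one (w 0 1 / (w 1 1 - w 0 0)), w 0 0, ht, by rw [← h11, htr], ?_⟩
    have hne' : w 1 1 - w 0 0 ≠ 0 := by rwa [← neg_sub, neg_ne_zero]
    rw [mul_assoc, inv_mul_eq_iff_eq_mul]
    apply Subtype.ext
    rw [coe_mul, coe_mul, transvection_zero_one_coe, diag2_coe',
      Matrix.eta_fin_two (w : Matrix (Fin 2) (Fin 2) F), hc, h11]
    rw [h11] at hne'
    simp
    field_simp
    have h1 : 1 - w 0 0 ^ 2 ≠ 0 := by
      intro h
      apply hne'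
      field_simp
      rw [h, mul_zero]
    field_simp
    ring
  · have hs := sub_inv_ne_zero_of_sq_ne_one hκ hκ2
    have hκi := mul_inv_cancel₀ hκ
    generalize hν : κ⁻¹ = ν at *
    let P : SL(2, F) := ⟨!![(κ - w 1 1) / (w 1 0 * (κ - ν)), ν - w 1 1; 1 / (κ - ν), w 1 0], by
      simp [Matrix.det_fin_two]
      field_simp
      ring⟩
    refine ⟨P, κ, hκ, by rw [hν], ?_⟩
    rw [mul_assoc, inv_mul_eq_iff_eq_mul]
    apply Subtype.ext
    rw [coe_mul, coe_mul, diag2_coe',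
      Matrix.eta_fin_two (w : Matrix (Fin 2) (Fin 2) F)]
    simp [P, hν]
    refine ⟨⟨?_, ?_⟩, ?_, ?_⟩
    · field_simp
      linear_combination κ * htr - hd + hκi
    · linear_combination ν * htr - hd + hκi
    · field_simp
      ring
    · ring

variable [Finite F]

lemma eq_top_of_sq_lt_card_of_diag2_mem {H : Subgroup SL(2, F)}
    (hT : ∀ (t : F) (ht : t ≠ 0), diag2 t ht ∈ H) (hcard : Nat.card F ^ 2 < Nat.card H) :
    H = ⊤ := by
  have hlt : Nat.card (F × F) < Nat.card H := by rwa [Nat.card_prod, ← sq]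
  obtain ⟨g, hg, hg0⟩ : ∃ g ∈ H, g 1 0 ≠ 0 := by
    by_contra! h
    refine hlt.not_ge (Nat.card_le_card_of_injective (fun g : H ↦ (g.1 0 0, g.1 0 1)) ?_)
    rintro ⟨x, hx⟩ ⟨y, hy⟩ hxy
    obtain ⟨h1, h2⟩ := Prod.mk.inj hxy
    simp only at h1 h2
    have dx := fin_two_det x
    have dy := fin_two_det y
    rw [h x hx, mul_zero, sub_zero] at dx
    rw [h y hy, mul_zero, sub_zero] at dy
    have h3 : x 1 1 = y 1 1 :=
      mul_left_cancel₀ (left_ne_zero_of_mul_eq_one dx) (by rw [dx, h1, dy])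
    refine Subtype.ext ?_
    ext i j
    fin_cases i <;> fin_cases j <;> simp [h1, h2, h3, h x hx, h y hy]
  obtain ⟨⟨x, hx⟩, ⟨y, hy⟩, hxy, hne⟩ : ∃ x y : H, (x.1 0 0, x.1 1 0) = (y.1 0 0, y.1 1 0) ∧
      x ≠ y := by
    by_contra! h
    exact hlt.not_ge (Nat.card_le_card_of_injective (fun g : H ↦ (g.1 0 0, g.1 1 0)) h)
  obtain ⟨h1, h2⟩ := Prod.mk.inj hxy
  simp only at h1 h2
  have dx := fin_two_det x
  have dy := fin_two_det y
  refine eq_top_of_upper_mem hT (H.mul_mem (H.inv_mem hx) hy) ?_ ?_ hg hg0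
  · simp [coe_inv, Matrix.adjugate_fin_two, Matrix.mul_apply, Fin.sum_univ_two]
    rw [← h1, ← h2]
    ring
  · intro h
    simp [coe_inv, Matrix.adjugate_fin_two, Matrix.mul_apply, Fin.sum_univ_two] at h
    rw [← h1, ← h2] at dy
    have e1 : x 1 1 = y 1 1 := by linear_combination y 1 1 * dx - x 1 1 * dy - x 1 0 * h
    have e2 : x 0 1 = y 0 1 := by linear_combination y 0 1 * dx - x 0 1 * dy - x 0 0 * h
    refine hne (Subtype.ext ?_)
    ext i j
    fin_cases i <;> fin_cases j <;> simp [h1, h2, e1, e2]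

lemma eq_top_of_sq_lt_card {H : Subgroup SL(2, F)} {w : SL(2, F)} (hw : w ∈ H) {κ : F}
    (hκ : κ ≠ 0) (hκ2 : κ ^ 2 ≠ 1) (hord : orderOf κ = Nat.card F - 1)
    (htr : w 0 0 + w 1 1 = κ + κ⁻¹) (hcard : Nat.card F ^ 2 < Nat.card H) : H = ⊤ := by
  obtain ⟨g, t, ht, htκ, hg⟩ := exists_conj_eq_diag2 hκ hκ2 htr
  have hK : Nat.card (H.map (MulAut.conj g⁻¹).toMonoidHom) = Nat.card H :=
    Subgroup.card_map_of_injective (MulAut.conj g⁻¹).injective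
  have hmem : diag2 t ht ∈ H.map (MulAut.conj g⁻¹).toMonoidHom := ⟨w, hw, by simp [hg]⟩
  have hmem' : diag2 κ hκ ∈ H.map (MulAut.conj g⁻¹).toMonoidHom := by
    have h0 : (t - κ) * (t - κ⁻¹) = 0 := by
      linear_combination t * htκ + mul_inv_cancel₀ hκ - mul_inv_cancel₀ ht
    rcases mul_eq_zero.1 h0 with h | h
    · obtain rfl := sub_eq_zero.1 h
      exact hmem
    · obtain rfl := sub_eq_zero.1 h
      have := Subgroup.inv_mem _ hmem
      rw [diag2_inv] at this
      simpa using this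
  have htop := eq_top_of_sq_lt_card_of_diag2_mem (diag2_mem_of_orderOf hκ hord hmem') (hK ▸ hcard)
  rw [htop, Nat.card_congr Subgroup.topEquiv.toEquiv] at hK
  exact Subgroup.eq_top_of_card_eq _ hK.symm

end Exceptional

section Orders

variable {F : Type*} [Field F]

lemma exists_add_inv_eq {L : Type*} [Field L] [IsAlgClosed L] (σ : L) :
    ∃ x : L, x ≠ 0 ∧ x ^ 2 - σ * x + 1 = 0 ∧ x + x⁻¹ = σ := by
  obtain ⟨x, hx⟩ := IsAlgClosed.exists_root
    (Polynomial.C 1 * Polynomial.X ^ 2 + Polynomial.C (-σ) * Polynomial.X + Polynomial.C 1)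
    (by rw [Polynomial.degree_quadratic one_ne_zero]; norm_num)
  have h : x ^ 2 - σ * x + 1 = 0 := by
    rw [Polynomial.IsRoot.def] at hx
    simp only [Polynomial.eval_add, Polynomial.eval_mul, Polynomial.eval_C, Polynomial.eval_pow,
      Polynomial.eval_X] at hx
    linear_combination hx
  have hx0 : x ≠ 0 := by
    rintro rfl
    simp at h
  refine ⟨x, hx0, h, ?_⟩
  field_simp
  linear_combination h

lemma orderOf_eq_twenty_four {σ : F} (h5 : (5 : F) = 0) (hσ : σ ^ 4 - 4 * σ ^ 2 + 1 = 0)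
    {w : SL(2, F)} (hw : w 0 0 + w 1 1 = σ) : orderOf w = 24 := by
  obtain ⟨x, hx0, hx, hxi⟩ := exists_add_inv_eq (algebraMap F (AlgebraicClosure F) σ)
  have hσ' := congrArg (algebraMap F (AlgebraicClosure F)) hσ
  have h5' := congrArg (algebraMap F (AlgebraicClosure F)) h5
  simp only [map_add, map_sub, map_mul, map_pow, map_one, map_zero, map_ofNat] at hσ' h5'
  generalize hσs : algebraMap F (AlgebraicClosure F) σ = s at *
  have h8 : x ^ 8 - x ^ 4 + 1 = 0 := by
    have hs : s * x = x ^ 2 + 1 := by linear_combination -hx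
    have : (s * x) ^ 4 - 4 * (s * x) ^ 2 * x ^ 2 + x ^ 4 = 0 := by linear_combination x ^ 4 * hσ'
    rw [hs] at this
    linear_combination this
  have h12 : x ^ 12 = -1 := by linear_combination (x ^ 4 + 1) * h8
  have ne1 : (-1 : AlgebraicClosure F) ≠ 1 := by
    intro h
    exact one_ne_zero (α := AlgebraicClosure F) (by linear_combination h5' + 2 * h)
  have h8' : x ^ 8 ≠ 1 := by
    intro h
    have h4 : x ^ 4 = 2 := by linear_combination h - h8
    exact one_ne_zero (α := AlgebraicClosure F)
      (by linear_combination 2 * h5' - 3 * h + 3 * (x ^ 4 + 2) * h4)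
  have hord : orderOf x = 24 := by
    refine orderOf_eq_of_pow_and_pow_div_prime (by norm_num) ?_ fun p hp hdvd ↦ ?_
    · linear_combination (x ^ 12 - 1) * h12
    · rw [show 24 = 2 ^ 3 * 3 by norm_num, hp.dvd_mul] at hdvd
      rcases hdvd with h | h
      · rw [(Nat.prime_dvd_prime_iff_eq hp Nat.prime_two).1 (hp.dvd_of_dvd_pow h)]
        exact fun h ↦ ne1 (h12 ▸ h)
      · rw [(Nat.prime_dvd_prime_iff_eq hp Nat.prime_three).1 h]
        exact h8'
  rw [orderOf_eq_of_trace hx0 ?_ (by rw [hw, hσs, hxi]), hord]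
  exact pow_ne_one_of_lt_orderOf (by norm_num) (by omega)

lemma orderOf_eq_eight {x : F} (h2 : (2 : F) ≠ 0) (hx : x ^ 4 = -1) : orderOf x = 8 := by
  refine orderOf_eq_prime_pow (p := 2) (n := 2) ?_ ?_
  · norm_num
    rw [hx]
    intro h
    exact h2 (by linear_combination -h)
  · norm_num
    linear_combination (x ^ 4 - 1) * hx

end Orders

open FiniteField

section NonSplit

variable {F L : Type*} [Field F] [Field L] [Algebra F L] {l : L} {τ : F}

lemma trace_relation (hl0 : l ≠ 0) (hτ : algebraMap F L τ = -l + (-l)⁻¹) :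
    algebraMap F L τ * l = -(l ^ 2 + 1) := by
  rw [hτ]
  field_simp
  ring

lemma pow_eq_neg_one_of_orderOf {k : ℕ} (hk : k ≠ 0) (hl : orderOf l = 2 * k) : l ^ k = -1 := by
  have h := pow_orderOf_eq_one l
  rw [hl, mul_comm, pow_mul] at h
  exact (mul_self_eq_one_iff.1 (by rw [← sq, h])).resolve_left
    (pow_ne_one_of_lt_orderOf hk (by omega))

lemma conj_companion_ne {A B : SL(2, F)} (hA : A 0 0 + A 1 1 = τ) (hB : B 0 0 + B 1 1 = τ)
    (hAB : (A * B) 0 0 + (A * B) 1 1 = τ) (h0 : τ ≠ 0) (h1 : τ ^ 2 ≠ 1) (h2 : τ ^ 2 ≠ 4) :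
    B * A * B⁻¹ ≠ A ∧ B * A * B⁻¹ ≠ A⁻¹ := by
  have h2' : τ - 2 ≠ 0 := fun h ↦ h2 (by linear_combination (τ + 2) * h)
  constructor
  · intro h
    have ht := trace_commutator A B
    have : A * B * A⁻¹ * B⁻¹ = 1 := by
      nth_rewrite 1 [← h]
      group
    rw [this, hA, hB, hAB] at ht
    simp at ht
    have : (τ - 2) * ((τ - 2) * (τ + 1)) = 0 := by linear_combination ht
    have h3 := (mul_eq_zero.1 ((mul_eq_zero.1 this).resolve_left h2')).resolve_left h2'
    exact h1 (by linear_combination (τ - 1) * h3)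
  · intro h
    have ht := trace_mul_inv B A
    have : B * A⁻¹ = A * B := by
      have : A = B * A⁻¹ * B⁻¹ := by
        have := congrArg (·⁻¹) h
        simpa [mul_assoc] using this.symm
      exact (eq_mul_inv_iff_mul_eq.1 this).symm
    have hBA : (B * A) 0 0 + (B * A) 1 1 = τ := by
      rw [← hAB]
      simp [Matrix.mul_apply, Fin.sum_univ_two]
      ring
    rw [this, hA, hB, hAB, hBA] at ht
    have : τ * (τ - 2) = 0 := by linear_combination -ht
    exact mul_ne_zero h0 h2' this

variable [Fintype F]

lemma frobenius_neg_of_orderOf (hl : orderOf l = Fintype.card F + 1) :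
    frobeniusAlgHom F L (-l) = (-l)⁻¹ := by
  rw [map_neg, inv_neg, neg_inj]
  refine eq_inv_of_mul_eq_one_left ?_
  change l ^ Fintype.card F * l = 1
  rw [← pow_succ, ← hl, pow_orderOf_eq_one]

lemma neg_notMem_range (hl : orderOf l = Fintype.card F + 1) :
    -l ∉ Set.range (algebraMap F L) := by
  rintro ⟨y, hy⟩
  have h := frobenius_neg_of_orderOf hl
  rw [← hy, AlgHom.commutes, hy] at h
  have hl0 : l ≠ 0 := by
    rintro rfl
    simp at hl
  refine pow_ne_one_of_lt_orderOf (x := l) two_ne_zero ?_ ?_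
  · have := Fintype.one_lt_card (α := F)
    omega
  · field_simp at h
    linear_combination -h

lemma trace_eq_of_card_nine (h9 : Fintype.card F = 9) (hl : orderOf l = Fintype.card F + 1)
    (hτ : algebraMap F L τ * l = -(l ^ 2 + 1)) : (3 : F) = 0 ∧ τ ^ 2 + τ - 1 = 0 := by
  constructor
  · have := FiniteField.cast_card_eq_zero F
    rw [h9] at this
    rw [← sq_eq_zero_iff, ← this]
    norm_num
  rw [h9] at hl
  have h5 := pow_eq_neg_one_of_orderOf (k := 5) (by norm_num) (by omega)
  have hl0 : l ≠ 0 := by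
    rintro rfl
    simp at hl
  have h1 : l + 1 ≠ 0 := by
    intro h
    refine pow_ne_one_of_lt_orderOf (x := l) (n := 2) two_ne_zero (by omega) ?_
    linear_combination (l - 1) * h
  have h4 : l ^ 4 - l ^ 3 + l ^ 2 - l + 1 = 0 :=
    mul_left_cancel₀ h1 (by linear_combination h5)
  refine FaithfulSMul.algebraMap_injective F L (mul_left_cancel₀ (pow_ne_zero 2 hl0) ?_)
  simp only [map_add, map_sub, map_pow, map_one, map_zero]
  linear_combination (algebraMap F L τ * l - (l ^ 2 + 1) + l) * hτ + h4

lemma trace_eq_of_card_twenty_five (h25 : Fintype.card F = 25)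
    (hl : orderOf l = Fintype.card F + 1) (hτ : algebraMap F L τ * l = -(l ^ 2 + 1)) :
    (5 : F) = 0 ∧ τ ^ 6 + τ ^ 5 - 5 * τ ^ 4 - 4 * τ ^ 3 + 6 * τ ^ 2 + 3 * τ - 1 = 0 := by
  constructor
  · have := FiniteField.cast_card_eq_zero F
    rw [h25] at this
    rw [← sq_eq_zero_iff, ← this]
    norm_num
  rw [h25] at hl
  have h5 := pow_eq_neg_one_of_orderOf (k := 13) (by norm_num) (by omega)
  have hl0 : l ≠ 0 := by
    rintro rfl
    simp at hl
  have h1 : l + 1 ≠ 0 := by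
    intro h
    refine pow_ne_one_of_lt_orderOf (x := l) (n := 2) two_ne_zero (by omega) ?_
    linear_combination (l - 1) * h
  refine FaithfulSMul.algebraMap_injective F L (mul_left_cancel₀ (pow_ne_zero 6 hl0) ?_)
  simp only [map_add, map_sub, map_mul, map_pow, map_one, map_zero, map_ofNat]
  generalize algebraMap F L τ = t at *
  have e : (t * l) ^ 6 + (t * l) ^ 5 * l - 5 * (t * l) ^ 4 * l ^ 2 - 4 * (t * l) ^ 3 * l ^ 3 +
      6 * (t * l) ^ 2 * l ^ 4 + 3 * (t * l) * l ^ 5 - l ^ 6 = 0 := by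
    rw [hτ]
    exact mul_left_cancel₀ h1 (by linear_combination h5)
  linear_combination e

end NonSplit

section NonSplitPair

variable {F : Type*} [Field F]

lemma eq_top_of_card_nine [Finite F] (h9 : Nat.card F = 9) {τ : F} (h3 : (3 : F) = 0)
    (hτ : τ ^ 2 + τ - 1 = 0) {A B : SL(2, F)} (hA : A 0 0 + A 1 1 = τ) (hB : B 0 0 + B 1 1 = τ)
    (hAB : (A * B) 0 0 + (A * B) 1 1 = τ) {H : Subgroup SL(2, F)} (hAH : A ∈ H) (hBH : B ∈ H)
    {N : ℕ} (hN : N = 6 ∨ N = 12) (hcard : Nat.card H = 10 * N) : H = ⊤ := by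
  have hwH : A * B * A⁻¹ * B⁻¹ ∈ H :=
    H.mul_mem (H.mul_mem (H.mul_mem hAH hBH) (H.inv_mem hAH)) (H.inv_mem hBH)
  have hw := trace_commutator A B
  rw [hA, hB, hAB] at hw
  generalize A * B * A⁻¹ * B⁻¹ = w at hwH hw
  have h2 : (2 : F) ≠ 0 := fun h ↦ one_ne_zero (α := F) (by linear_combination h3 - h)
  have hκ4 : (-τ) ^ 4 = -1 := by
    linear_combination (τ ^ 2 - τ + 2) * hτ + (1 - τ) * h3
  have hκ8 := orderOf_eq_eight h2 hκ4
  have hκ0 : -τ ≠ 0 := by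
    intro h
    simp [h] at hκ4
  have hκ2 : (-τ) ^ 2 ≠ 1 := pow_ne_one_of_lt_orderOf two_ne_zero (by omega)
  have htr : w 0 0 + w 1 1 = -τ + (-τ)⁻¹ := by
    rw [hw]
    refine mul_right_cancel₀ hκ0 ?_
    rw [add_mul, inv_mul_cancel₀ hκ0]
    linear_combination (τ ^ 2 - 4 * τ + 4) * hτ + (1 - 2 * τ) * h3
  rcases hN with rfl | rfl
  · have h8 : orderOf w = 8 := by
      rw [orderOf_eq_of_trace (L := F) hκ0 hκ2 htr, hκ8]
    have := H.orderOf_dvd_natCard hwH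
    rw [h8, hcard] at this
    norm_num at this
  · exact eq_top_of_sq_lt_card hwH hκ0 hκ2 (by omega) htr (by rw [h9, hcard]; norm_num)

lemma twenty_four_dvd_card (h5 : (5 : F) = 0) {τ : F}
    (hτ : τ ^ 6 + τ ^ 5 - 5 * τ ^ 4 - 4 * τ ^ 3 + 6 * τ ^ 2 + 3 * τ - 1 = 0) {A B : SL(2, F)}
    (hA : A 0 0 + A 1 1 = τ) (hB : B 0 0 + B 1 1 = τ) (hAB : (A * B) 0 0 + (A * B) 1 1 = τ)
    {H : Subgroup SL(2, F)} (hAH : A ∈ H) (hBH : B ∈ H) : 24 ∣ Nat.card H := by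
  have h₁ : (A * B⁻¹) 0 0 + (A * B⁻¹) 1 1 = τ ^ 2 - τ := by
    rw [trace_mul_inv, hA, hB, hAB, sq]
  have hB' : B⁻¹ 0 0 + B⁻¹ 1 1 = τ := by
    rw [← hB]
    simp [coe_inv, Matrix.adjugate_fin_two, add_comm]
  have h₂ := trace_sq_mul A B⁻¹
  rw [hA, h₁, hB'] at h₂
  have h₃ := trace_sq_mul A (A * B⁻¹)
  rw [hA, h₁, h₂] at h₃
  have key : ((τ ^ 2 - τ) ^ 4 - 4 * (τ ^ 2 - τ) ^ 2 + 1) *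
      ((τ * (τ * (τ ^ 2 - τ) - τ) - (τ ^ 2 - τ)) ^ 4 -
        4 * (τ * (τ * (τ ^ 2 - τ) - τ) - (τ ^ 2 - τ)) ^ 2 + 1) = 0 := by
    linear_combination (-1 + 2 * τ - 2 * τ ^ 2 + τ ^ 3 + 2 * τ ^ 4 + τ ^ 5 + τ ^ 6 + τ ^ 7 -
      2 * τ ^ 8 - τ ^ 9 + 2 * τ ^ 10 - 2 * τ ^ 11 - 2 * τ ^ 13 - 2 * τ ^ 14 - τ ^ 15 - τ ^ 16 +
      τ ^ 17 + τ ^ 18) * hτ + (τ - 2 * τ ^ 2 + 3 * τ ^ 3 + 4 * τ ^ 4 - 28 * τ ^ 5 + 37 * τ ^ 6 +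
      9 * τ ^ 7 - 100 * τ ^ 8 + 105 * τ ^ 9 + 47 * τ ^ 10 - 191 * τ ^ 11 + 122 * τ ^ 12 +
      106 * τ ^ 13 - 195 * τ ^ 14 + 58 * τ ^ 15 + 94 * τ ^ 16 - 94 * τ ^ 17 + 10 * τ ^ 18 +
      30 * τ ^ 19 - 22 * τ ^ 20 + 3 * τ ^ 21 + 5 * τ ^ 22 - 2 * τ ^ 23) * h5
  have hAB' := H.mul_mem hAH (H.inv_mem hBH)
  rcases mul_eq_zero.1 key with h | h
  · rw [← orderOf_eq_twenty_four h5 h h₁]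
    exact H.orderOf_dvd_natCard hAB'
  · rw [← orderOf_eq_twenty_four h5 h h₃]
    exact H.orderOf_dvd_natCard (H.mul_mem hAH (H.mul_mem hAH hAB'))

variable {L : Type*} [Field L] [Algebra F L] {l : L} {τ : F}

lemma eq_top_of_nonsplit_torus [Fintype F] (hq : 7 < Fintype.card F)
    (hpp : IsPrimePow (Fintype.card F)) (hl : orderOf l = Fintype.card F + 1) (hl0 : l ≠ 0)
    (hτ : algebraMap F L τ = -l + (-l)⁻¹) (h0 : τ ≠ 0) (h1 : τ ^ 2 ≠ 1) (h4 : τ ^ 2 ≠ 4)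
    {B : SL(2, F)} (hB : B 0 0 + B 1 1 = τ)
    (hAB : (companion τ * B) 0 0 + (companion τ * B) 1 1 = τ) {H : Subgroup SL(2, F)}
    (hZ : Subgroup.center SL(2, F) ≤ H) (hAH : companion τ ∈ H) (hBH : B ∈ H) : H = ⊤ := by
  have hA : companion τ 0 0 + companion τ 1 1 = τ := by simp [companion_coe]
  obtain ⟨hne, hne'⟩ := conj_companion_ne hA hB hAB h0 h1 h4
  obtain ⟨N, j, ε, hε, hj, hcard, hNM, hN⟩ := exists_index_eq (frobenius_neg_of_orderOf hl)
    (neg_ne_zero.2 hl0) (neg_notMem_range hl) hτ (by rw [neg_neg, hl]) hZ hAH hBH hne hne'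
  rcases index_eq_of_isPrimePow hq hpp hε hj hNM hN with h | h | ⟨h, hN'⟩ | ⟨h, hN'⟩
  · exact Subgroup.index_eq_one.1 h
  · exact (index_ne_two h0 h1 H h).elim
  · obtain ⟨h3, hτ'⟩ := trace_eq_of_card_nine h hl (trace_relation hl0 hτ)
    exact eq_top_of_card_nine (by rw [Nat.card_eq_fintype_card, h]) h3 hτ' hA hB hAB hAH hBH hN'
      (by rw [hcard, h])
  · obtain ⟨h5, hτ'⟩ := trace_eq_of_card_twenty_five h hl (trace_relation hl0 hτ)
    have := twenty_four_dvd_card h5 hτ' hA hB hAB hAH hBH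
    rw [hcard, h] at this
    rcases hN' with rfl | rfl <;> norm_num at this

/-- A generating pair of `PSL₂(q)` with constant order `(q + 1) / gcd(2, q - 1)`. -/
lemma exists_nonsplit_pair [Fintype F] (hq : 7 < Fintype.card F)
    (hpp : IsPrimePow (Fintype.card F)) :
    ∃ a b : PSL2 F, Subgroup.closure {a, b} = ⊤ ∧
      orderOf a = (Fintype.card F + 1) / Nat.gcd 2 (Fintype.card F - 1) ∧
      orderOf b = (Fintype.card F + 1) / Nat.gcd 2 (Fintype.card F - 1) ∧
      orderOf (a * b) = (Fintype.card F + 1) / Nat.gcd 2 (Fintype.card F - 1) := by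
  obtain ⟨l, hl⟩ := exists_orderOf_eq_card_add_one (F := F) (L := AlgebraicClosure F)
  have hl0 : l ≠ 0 := by
    rintro rfl
    simp at hl
  have hpow {n : ℕ} (hn : n ≠ 0) (hn' : n ≤ 8) : l ^ n ≠ 1 :=
    pow_ne_one_of_lt_orderOf hn (by omega)
  have hl2 : l ^ 2 ≠ 1 := hpow two_ne_zero (by omega)
  have hφ := frobenius_neg_of_orderOf hl
  obtain ⟨τ, hτ⟩ := exists_algebraMap_eq_add_inv hφ
  have hrel := trace_relation hl0 hτ
  have h0 : τ ≠ 0 := by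
    rintro rfl
    rw [map_zero] at hrel
    exact hpow (n := 4) (by norm_num) (by norm_num) (by linear_combination (l ^ 2 - 1) * hrel)
  have hrel2 {c : F} (hc : τ ^ 2 = c) : algebraMap F _ c * l ^ 2 = (l ^ 2 + 1) ^ 2 := by
    rw [← hc, map_pow, ← mul_pow, hrel, neg_sq]
  have h1 : τ ^ 2 ≠ 1 := by
    intro h
    have := hrel2 h
    rw [map_one] at this
    exact hpow (n := 6) (by norm_num) (by norm_num) (by linear_combination (1 - l ^ 2) * this)
  have h4 : τ ^ 2 ≠ 4 := by
    intro h
    have := hrel2 h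
    rw [map_ofNat] at this
    have : (l ^ 2 - 1) ^ 2 = 0 := by linear_combination -this
    exact hl2 (sub_eq_zero.1 (pow_eq_zero_iff two_ne_zero |>.1 this))
  obtain ⟨z, w, hzw⟩ := exists_det_eq_one hφ (neg_ne_zero.2 hl0) (by rwa [neg_sq]) hτ
    fun h ↦ h4 (by linear_combination (τ - 2) * h)
  let B : SL(2, F) := ⟨!![τ - w, τ - τ * w + z; z, w], by rw [Matrix.det_fin_two_of, hzw]⟩
  have hA : companion τ 0 0 + companion τ 1 1 = τ := by simp [companion_coe]
  have hB : B 0 0 + B 1 1 = τ := by simp [B]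
  have hAB : (companion τ * B) 0 0 + (companion τ * B) 1 1 = τ := by
    rw [companion_mul_coe]
    simp [B]
    ring
  have hgcd : Nat.gcd 2 (Fintype.card F - 1) = Nat.gcd 2 (Fintype.card F + 1) := by
    rw [show Fintype.card F + 1 = Fintype.card F - 1 + 2 by omega, Nat.gcd_add_self_right]
  rw [hgcd, ← hl]
  exact exists_pair_of_trace hl0 hl2 (by rw [hA, hτ]) (by rw [hB, hτ]) (by rw [hAB, hτ])
    fun H hZ hAH hBH ↦ eq_top_of_nonsplit_torus hq hpp hl hl0 hτ h0 h1 h4 hB hAB hZ hAH hBH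

end NonSplitPair

end Matrix.SpecialLinearGroup

/-- Let `q > 7` be a prime power and `d = gcd(2, q - 1)`.  Then `PSL₂(q)`
admits an unmixed Beauville structure of type
`(((q-1)/d, (q-1)/d, (q-1)/d), ((q+1)/d, (q+1)/d, (q+1)/d))`. -/
theorem beauville_type_split_nonsplit_PSL2 (p e : ℕ) (hp : p.Prime) (he : 0 < e)
    (hq : 7 < p ^ e)
    (F : Type*) [Field F] [Fintype F] (hF : Fintype.card F = p ^ e) :
    HasBeauvilleOfType (PSL2 F)
      ((p ^ e - 1) / Nat.gcd 2 (p ^ e - 1)) ((p ^ e - 1) / Nat.gcd 2 (p ^ e - 1))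
      ((p ^ e - 1) / Nat.gcd 2 (p ^ e - 1)) ((p ^ e + 1) / Nat.gcd 2 (p ^ e - 1))
      ((p ^ e + 1) / Nat.gcd 2 (p ^ e - 1)) ((p ^ e + 1) / Nat.gcd 2 (p ^ e - 1)) := by
  have hcard : Nat.card F = p ^ e := by rw [Nat.card_eq_fintype_card, hF]
  have hpp : IsPrimePow (p ^ e) := hp.isPrimePow.pow he.ne'
  obtain ⟨a₁, b₁, h₁, ha₁, hb₁, hc₁⟩ := exists_split_pair (F := F) (by rwa [hcard]) (by rwa [hcard])
  obtain ⟨a₂, b₂, h₂, ha₂, hb₂, hc₂⟩ :=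
    Matrix.SpecialLinearGroup.exists_nonsplit_pair (F := F) (by rwa [hF]) (by rwa [hF])
  rw [hcard] at ha₁ hb₁ hc₁
  rw [hF] at ha₂ hb₂ hc₂
  exact HasBeauvilleOfType.of_coprime (Nat.coprime_half_sub_half_add (by omega)) h₁ h₂ ha₁ hb₁ hc₁
    ha₂ hb₂ hc₂
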